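/- Assume Setup (†). Then for all sufficiently large n, the partition is balanced: for all 1 ≤ i < j ≤ r, ||V_i| − |V_j|| ≤ 1. -/

import Mathlib

open SimpleGraph

/-- The adjacency matrix of a simple graph over `ℝ`. -/
noncomputable def adjMat {V : Type*} [Fintype V] (G : SimpleGraph V) : Matrix V V ℝ :=
  letI := Classical.decRel G.Adj
  G.adjMatrix ℝ

/-- The spectral radius of a simple graph: the largest eigenvalue of its adjacency matrix. -/
noncomputable def specRad {V : Type*} [Fintype V] [DecidableEq V] (G : SimpleGraph V) : ℝ :=
  sSup (spectrum ℝ (adjMat G))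

/-- The number of edges of a simple graph. -/
noncomputable def eCnt {V : Type*} (G : SimpleGraph V) : ℕ := Nat.card G.edgeSet

/-- `G` contains a copy of `F` (a subgraph isomorphic to `F`). -/
def Contains {W V : Type*} (F : SimpleGraph W) (G : SimpleGraph V) : Prop :=
  ∃ f : F →g G, Function.Injective f

/-- `G` is `F`-free. -/
def FFree {W V : Type*} (F : SimpleGraph W) (G : SimpleGraph V) : Prop := ¬ Contains F G

/-- The Turán number `ex(n, F)`. -/
noncomputable def exNum {W : Type*} (n : ℕ) (F : SimpleGraph W) : ℕ :=
  sSup {m | ∃ G : SimpleGraph (Fin n), FFree F G ∧ eCnt G = m}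

/-- `G` is obtained from the Turán graph `T_{n,r}` by adding `a` edges. -/
def TuranPlus (n r a : ℕ) (G : SimpleGraph (Fin n)) : Prop :=
  (∃ H : SimpleGraph (Fin n), H ≤ G ∧ Nonempty (H ≃g turanGraph n r)) ∧
    eCnt G = eCnt (turanGraph n r) + a

/-- Hypothesis (★): for all sufficiently large `m`, `ex(m,F) = e(T_{m,r}) + a` and every
extremal graph is obtained from `T_{m,r}` by adding `a` edges. -/
def HypStar {W : Type*} (r a : ℕ) (F : SimpleGraph W) : Prop :=
  ∃ m₀ : ℕ, ∀ m ≥ m₀,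
    exNum m F = eCnt (turanGraph m r) + a ∧
    ∀ G : SimpleGraph (Fin m), FFree F G → eCnt G = exNum m F → TuranPlus m r a G

/-- `G` is a spectral-extremal `F`-free graph on its vertex set. -/
def SpecExtremal {W : Type*} (F : SimpleGraph W) {n : ℕ} (G : SimpleGraph (Fin n)) : Prop :=
  FFree F G ∧ ∀ G' : SimpleGraph (Fin n), FFree F G' → specRad G' ≤ specRad G

/-- Number of edges of `G` joining two distinct parts of the partition `p`. -/
noncomputable def crossCnt {n r : ℕ} (G : SimpleGraph (Fin n)) (p : Fin n → Fin r) : ℕ :=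
  Nat.card {e : Sym2 (Fin n) // e ∈ G.edgeSet ∧ ¬ (Sym2.map p e).IsDiag}

/-- Number of edges of `G` inside part `i` of the partition `p`, i.e. `e(G[Vᵢ])`. -/
noncomputable def inCnt {n r : ℕ} (G : SimpleGraph (Fin n)) (p : Fin n → Fin r)
    (i : Fin r) : ℕ :=
  Nat.card {e : Sym2 (Fin n) // e ∈ G.edgeSet ∧ Sym2.map p e = Sym2.diag i}

/-- The size of part `i` of the partition `p`, i.e. `|Vᵢ|`. -/
noncomputable def partSize {n r : ℕ} (p : Fin n → Fin r) (i : Fin r) : ℕ :=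
  Nat.card {v : Fin n // p v = i}

/-- The degree of `v` in `G`. -/
noncomputable def deg {n : ℕ} (G : SimpleGraph (Fin n)) (v : Fin n) : ℕ :=
  Nat.card (G.neighborSet v)

/-- `d_{Vᵢ}(v)`, the number of neighbours of `v` in part `i` of the partition `p`. -/
noncomputable def degIn {n r : ℕ} (G : SimpleGraph (Fin n)) (p : Fin n → Fin r)
    (i : Fin r) (v : Fin n) : ℕ :=
  Nat.card {w : Fin n // G.Adj v w ∧ p w = i}

/-- The partition `p` into `r` parts maximizes the number of edges between distinct parts,
`∑ eᵢ(Vᵢ) ≤ ε n²`, and each part has size strictly between `(1/r − 3√ε)n` and `(1/r + 3√ε)n`. -/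
def GoodPartition (r : ℕ) {n : ℕ} (G : SimpleGraph (Fin n)) (ε : ℝ)
    (p : Fin n → Fin r) : Prop :=
  (∀ q : Fin n → Fin r, crossCnt G q ≤ crossCnt G p) ∧
  (∑ i : Fin r, (inCnt G p i : ℝ)) ≤ ε * n ^ 2 ∧
  ∀ i : Fin r, (1 / (r : ℝ) - 3 * Real.sqrt ε) * n < partSize p i ∧
    (partSize p i : ℝ) < (1 / (r : ℝ) + 3 * Real.sqrt ε) * n

/-- The set `L` of low-degree vertices. -/
def Lset (r : ℕ) {n : ℕ} (G : SimpleGraph (Fin n)) (ε : ℝ) : Set (Fin n) :=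
  {v | (deg G v : ℝ) ≤ (1 - 1 / (r : ℝ) - 3 * r * ε ^ ((1 : ℝ) / 3)) * n}

/-- The set `W` of vertices with many neighbours inside their own part. -/
def Wset {n r : ℕ} (G : SimpleGraph (Fin n)) (p : Fin n → Fin r) (θ : ℝ) : Set (Fin n) :=
  {v | 2 * θ * n ≤ (degIn G p (p v) v : ℝ)}

section
open scoped Classical

/-- The quadratic form of the adjacency matrix of `G`. -/
noncomputable def adjForm {n : ℕ} (G : SimpleGraph (Fin n)) (x : Fin n → ℝ) : ℝ :=
  ∑ u, ∑ v, if G.Adj u v then x u * x v else 0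

lemma adjMat_mulVec {n : ℕ} (G : SimpleGraph (Fin n)) (x : Fin n → ℝ) (u : Fin n) :
    (adjMat G).mulVec x u = ∑ v, if G.Adj u v then x v else 0 := by
  simp only [adjMat, Matrix.mulVec, dotProduct, SimpleGraph.adjMatrix_apply, ite_mul, one_mul,
    zero_mul]

lemma adjForm_eq_sum_mul {n : ℕ} (G : SimpleGraph (Fin n)) (x : Fin n → ℝ) :
    adjForm G x = ∑ u, x u * ∑ v, if G.Adj u v then x v else 0 := by
  unfold adjForm
  refine Finset.sum_congr rfl fun u _ => ?_
  rw [Finset.mul_sum]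
  exact Finset.sum_congr rfl fun v _ => by split_ifs <;> simp

lemma adjMat_isHermitian {n : ℕ} (G : SimpleGraph (Fin n)) : (adjMat G).IsHermitian := by
  ext u v
  simp [adjMat, SimpleGraph.adjMatrix_apply, G.adj_comm]

lemma bddAbove_spectrum_adjMat {n : ℕ} (G : SimpleGraph (Fin n)) :
    BddAbove (spectrum ℝ (adjMat G)) :=
  (Matrix.finite_real_spectrum).bddAbove

lemma adjForm_le_specRad {n : ℕ} (G : SimpleGraph (Fin n)) (y : Fin n → ℝ) :
    adjForm G y ≤ specRad G * ∑ u, y u ^ 2 := by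
  have hpsd : ((algebraMap ℝ (Matrix (Fin n) (Fin n) ℝ) (specRad G)) - adjMat G).PosSemidef := by
    rw [Matrix.posSemidef_iff_isHermitian_and_spectrum_nonneg]
    refine ⟨Matrix.IsHermitian.sub ?_ (adjMat_isHermitian G), ?_⟩
    · rw [Algebra.algebraMap_eq_smul_one]
      ext u v
      simp [Matrix.one_apply, eq_comm]
    · rw [← spectrum.singleton_sub_eq]
      rintro _ ⟨s, hs, t, ht, rfl⟩
      rw [Set.mem_singleton_iff] at hs
      subst hs
      exact sub_nonneg.2 (le_csSup (bddAbove_spectrum_adjMat G) ht)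
  have h := hpsd.dotProduct_mulVec_nonneg y
  rw [Matrix.sub_mulVec, Algebra.algebraMap_eq_smul_one, Matrix.smul_mulVec, Matrix.one_mulVec,
    dotProduct_sub] at h
  have h1 : star y ⬝ᵥ (adjMat G).mulVec y = adjForm G y := by
    rw [adjForm_eq_sum_mul]
    simp [dotProduct, adjMat_mulVec]
  have h2 : star y ⬝ᵥ (specRad G • y) = specRad G * ∑ u, y u ^ 2 := by
    simp only [dotProduct, Finset.mul_sum]
    exact Finset.sum_congr rfl fun v _ => by simp; ring
  linarith

lemma specRad_mem_spectrum {n : ℕ} (hn : 0 < n) (G : SimpleGraph (Fin n)) :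
    specRad G ∈ spectrum ℝ (adjMat G) := by
  refine Set.Nonempty.csSup_mem ?_ Matrix.finite_real_spectrum
  exact ⟨_, (adjMat_isHermitian G).eigenvalues_mem_spectrum_real ⟨0, hn⟩⟩

lemma adjForm_update_add {n : ℕ} (G : SimpleGraph (Fin n)) (x : Fin n → ℝ) (w : Fin n) (t : ℝ) :
    adjForm G (fun u => x u + if u = w then t else 0) =
      adjForm G x + 2 * t * ∑ v, if G.Adj w v then x v else 0 := by
  have key : ∀ u v, (if G.Adj u v then (x u + if u = w then t else 0) *
      (x v + if v = w then t else 0) else 0) =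
      (if G.Adj u v then x u * x v else 0) +
      (if u = w then t * (if G.Adj w v then x v else 0) else 0) +
      (if v = w then t * (if G.Adj w u then x u else 0) else 0) := by
    intro u v
    by_cases hu : u = w <;> by_cases hv : v = w
    · subst hu; subst hv; simp
    · subst hu; simp [hv]; split_ifs <;> ring
    · subst hv; simp [hu, G.adj_comm v u]; split_ifs <;> ring
    · simp [hu, hv]
  simp only [adjForm, key, Finset.sum_add_distrib]
  have h1 : ∑ u, ∑ v, (if u = w then t * (if G.Adj w v then x v else 0) else 0) =
      t * ∑ v, if G.Adj w v then x v else 0 := by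
    rw [Finset.sum_comm, Finset.mul_sum]
    exact Finset.sum_congr rfl fun v _ => by simp
  have h2 : ∑ u, ∑ v, (if v = w then t * (if G.Adj w u then x u else 0) else 0) =
      t * ∑ v, if G.Adj w v then x v else 0 := by
    rw [Finset.mul_sum]
    exact Finset.sum_congr rfl fun v _ => by simp
  rw [h1, h2]; ring

lemma sum_sq_update_add {n : ℕ} (x : Fin n → ℝ) (w : Fin n) (t : ℝ) :
    ∑ u, (x u + if u = w then t else 0) ^ 2 = ∑ u, x u ^ 2 + 2 * t * x w + t ^ 2 := by
  have key : ∀ u, (x u + if u = w then t else 0) ^ 2 =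
      x u ^ 2 + (if u = w then 2 * t * x w + t ^ 2 else 0) := by
    intro u
    by_cases hu : u = w
    · subst hu; simp; ring
    · simp [hu]
  simp only [key, Finset.sum_add_distrib]
  simp; ring

lemma eq_zero_of_forall_quadratic_nonneg {b c : ℝ} (h : ∀ t : ℝ, 0 ≤ 2 * t * b + t ^ 2 * c) :
    b = 0 := by
  have hd := discrim_le_zero (a := c) (b := 2 * b) (c := 0) (fun t => by nlinarith [h t])
  simp only [discrim] at hd
  nlinarith

/-- A vector attaining the Rayleigh bound satisfies the eigenvalue equation. -/
lemma eigen_equation_of_adjForm_eq {n : ℕ} (G : SimpleGraph (Fin n)) (x : Fin n → ℝ)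
    (hx : specRad G * ∑ u, x u ^ 2 ≤ adjForm G x) (w : Fin n) :
    specRad G * x w = ∑ v, if G.Adj w v then x v else 0 := by
  have h := eq_zero_of_forall_quadratic_nonneg
    (b := specRad G * x w - ∑ v, if G.Adj w v then x v else 0) (c := specRad G) (fun t => by
      have h1 := adjForm_le_specRad G (fun u => x u + if u = w then t else 0)
      rw [adjForm_update_add, sum_sq_update_add] at h1
      nlinarith)
  linarith

lemma exists_perron {n : ℕ} (hn : 0 < n) (G : SimpleGraph (Fin n)) :
    ∃ x : Fin n → ℝ, (∀ u, 0 ≤ x u) ∧ ∑ u, x u ^ 2 = n ∧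
      ∀ u, specRad G * x u = ∑ v, if G.Adj u v then x v else 0 := by
  have hmem := specRad_mem_spectrum hn G
  rw [← Matrix.spectrum_toLin', ← Module.End.hasEigenvalue_iff_mem_spectrum] at hmem
  obtain ⟨z, hz⟩ := hmem.exists_hasEigenvector
  have hzeq : ∀ u, (∑ v, if G.Adj u v then z v else 0) = specRad G * z u := by
    intro u
    rw [← adjMat_mulVec]
    have := congrFun hz.apply_eq_smul u
    simpa using this
  have hzne : z ≠ 0 := hz.2
  have hpos : 0 < ∑ u, z u ^ 2 := by
    obtain ⟨u, hu⟩ := Function.ne_iff.1 hzne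
    exact Finset.sum_pos' (fun _ _ => sq_nonneg _) ⟨u, Finset.mem_univ _, by
      have : z u ≠ 0 := hu
      positivity⟩
  set N := ∑ u, z u ^ 2 with hN
  set c := Real.sqrt (n / N) with hc
  have hcN : c ^ 2 * N = n := by
    rw [hc, Real.sq_sqrt (by positivity)]; field_simp
  have hsum : ∑ u, (c * |z u|) ^ 2 = n := by
    rw [← hcN, hN, Finset.mul_sum]
    exact Finset.sum_congr rfl fun u _ => by rw [mul_pow, sq_abs]
  refine ⟨fun u => c * |z u|, fun u => by positivity, hsum, fun u => ?_⟩
  refine eigen_equation_of_adjForm_eq G (fun u => c * |z u|) ?_ u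
  rw [hsum]
  have h1 : adjForm G z = specRad G * N := by
    rw [adjForm_eq_sum_mul, hN, Finset.mul_sum]
    exact Finset.sum_congr rfl fun u _ => by rw [hzeq]; ring
  have h2 : c ^ 2 * adjForm G z ≤ adjForm G (fun u => c * |z u|) := by
    unfold adjForm
    simp only [Finset.mul_sum]
    refine Finset.sum_le_sum fun u _ => Finset.sum_le_sum fun v _ => ?_
    split_ifs
    · have : z u * z v ≤ |z u| * |z v| := by rw [← abs_mul]; exact le_abs_self _
      nlinarith [mul_le_mul_of_nonneg_left this (sq_nonneg c)]
    · simp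
  rw [h1] at h2
  calc specRad G * (n : ℝ) = c ^ 2 * (specRad G * N) := by rw [← hcN]; ring
    _ ≤ _ := h2

end

section
open scoped Classical

lemma two_mul_eCnt {n : ℕ} (G : SimpleGraph (Fin n)) :
    (2 * eCnt G : ℝ) = ∑ u, ∑ v, if G.Adj u v then (1 : ℝ) else 0 := by
  have h := G.sum_degrees_eq_twice_card_edges
  have h1 : eCnt G = G.edgeFinset.card := by
    rw [eCnt, Nat.card_eq_fintype_card, SimpleGraph.edgeFinset_card]
  have h2 : ∀ u, (∑ v, if G.Adj u v then (1 : ℝ) else 0) = (G.degree u : ℝ) := by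
    intro u
    rw [Finset.sum_boole, ← SimpleGraph.card_neighborFinset_eq_degree]
    congr 2
    ext v; simp
  rw [h1, Finset.sum_congr rfl fun u _ => h2 u]
  exact_mod_cast h.symm

/-- The quadratic form of a complete multipartite graph. -/
lemma sum_ite_ne_part {n r : ℕ} (p : Fin n → Fin r) (x : Fin n → ℝ) :
    (∑ u, ∑ v, if p u ≠ p v then x u * x v else 0) =
      (∑ u, x u) ^ 2 - ∑ i, (∑ u with p u = i, x u) ^ 2 := by
  have h1 : ∀ u v, (if p u ≠ p v then x u * x v else 0) =
      x u * x v - ∑ i, (if p u = i then x u else 0) * (if p v = i then x v else 0) := by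
    intro u v
    by_cases h : p u = p v <;> simp [h]
  simp only [h1, Finset.sum_sub_distrib]
  congr 1
  · rw [sq, Finset.sum_mul_sum]
  · rw [Finset.sum_congr rfl fun u _ => Finset.sum_comm, Finset.sum_comm]
    refine Finset.sum_congr rfl fun i _ => ?_
    rw [sq, Finset.sum_filter, Finset.sum_mul_sum]

/-- The colour classes of the Turán graph `turanGraph n r`. -/
def turanPart (n : ℕ) {r : ℕ} (hr : 0 < r) (v : Fin n) : Fin r :=
  ⟨v % r, Nat.mod_lt _ hr⟩

lemma two_mul_eCnt_turanGraph {n r : ℕ} (hr : 0 < r) :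
    (2 * eCnt (turanGraph n r) : ℝ) =
      (n : ℝ) ^ 2 - ∑ i, (((Finset.univ.filter fun v => turanPart n hr v = i).card : ℕ) : ℝ) ^ 2 := by
  have h := sum_ite_ne_part (turanPart n hr) (fun _ => 1)
  simp only [Finset.sum_const, nsmul_eq_mul, mul_one, Finset.card_univ, Fintype.card_fin] at h
  rw [two_mul_eCnt, ← h]
  refine Finset.sum_congr rfl fun u _ => Finset.sum_congr rfl fun v _ => ?_
  have hadj : (turanGraph n r).Adj u v ↔ turanPart n hr u ≠ turanPart n hr v := by
    simp [turanGraph, turanPart]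
  by_cases h' : (turanGraph n r).Adj u v
  · rw [if_pos h', if_pos (hadj.1 h')]
  · rw [if_neg h', if_neg (mt hadj.2 h')]

lemma card_turanPart {n r : ℕ} (hr : 0 < r) (i : Fin r) :
    (Finset.univ.filter fun v => turanPart n hr v = i).card = n / r ∨
    (Finset.univ.filter fun v => turanPart n hr v = i).card = n / r + 1 := by
  have h : (Finset.univ.filter fun v => turanPart n hr v = i).card =
      Nat.count (· ≡ i [MOD r]) n := by
    rw [Nat.count_eq_card_filter_range, ← Finset.card_map Fin.valEmbedding]
    congr 1
    ext v
    simp only [Finset.mem_map, Finset.mem_filter, Finset.mem_univ, true_and, turanPart,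
      Fin.valEmbedding_apply, Finset.mem_range, Nat.ModEq, Fin.ext_iff,
      Nat.mod_eq_of_lt i.isLt]
    constructor
    · rintro ⟨w, hw, rfl⟩; exact ⟨w.isLt, hw⟩
    · rintro ⟨h1, h2⟩; exact ⟨⟨v, h1⟩, h2, rfl⟩
  rw [h, Nat.count_modEq_card _ hr]
  split_ifs <;> simp

lemma sum_card_part {n r : ℕ} (p : Fin n → Fin r) :
    ∑ i, (Finset.univ.filter fun v => p v = i).card = n := by
  have := Finset.card_eq_sum_card_fiberwise (s := Finset.univ) (t := Finset.univ) (f := p)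
    (fun _ _ => Finset.mem_coe.2 (Finset.mem_univ _))
  simpa using this.symm

lemma eCnt_turanGraph_pos {n r : ℕ} (hr : 2 ≤ r) (hn : 2 ≤ n) : 0 < eCnt (turanGraph n r) := by
  rw [eCnt, Nat.card_pos_iff]
  refine ⟨⟨s(⟨0, by omega⟩, ⟨1, by omega⟩), ?_⟩, inferInstance⟩
  simp [turanGraph, Nat.mod_eq_of_lt hr]

lemma eCnt_le {n : ℕ} (G : SimpleGraph (Fin n)) : eCnt G ≤ n ^ 2 := by
  have h := two_mul_eCnt G
  have h2 : (∑ u, ∑ v, if G.Adj u v then (1 : ℝ) else 0) ≤ ∑ _u : Fin n, ∑ _v : Fin n, (1 : ℝ) :=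
    Finset.sum_le_sum fun u _ => Finset.sum_le_sum fun v _ => by split_ifs <;> norm_num
  simp only [Finset.sum_const, nsmul_eq_mul, mul_one, Finset.card_univ, Fintype.card_fin] at h2
  have : (eCnt G : ℝ) ≤ (n : ℝ) ^ 2 := by
    have : (0 : ℝ) ≤ eCnt G := by positivity
    nlinarith
  exact_mod_cast this

lemma HypStar.turan_number {W : Type*} {r a : ℕ} {F : SimpleGraph W} (hr : 2 ≤ r)
    (h : HypStar r a F) : ∃ m₀ : ℕ, ∀ m ≥ m₀,
      (∀ G : SimpleGraph (Fin m), FFree F G → eCnt G ≤ eCnt (turanGraph m r) + a) ∧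
      ∃ G : SimpleGraph (Fin m), FFree F G ∧ eCnt G = eCnt (turanGraph m r) + a := by
  obtain ⟨m₀, hm₀⟩ := h
  refine ⟨max m₀ 2, fun m hm => ?_⟩
  have hex := (hm₀ m (le_trans (le_max_left _ _) hm)).1
  have hpos := eCnt_turanGraph_pos hr (le_trans (le_max_right _ _) hm)
  have hbdd : BddAbove {k | ∃ G : SimpleGraph (Fin m), FFree F G ∧ eCnt G = k} :=
    ⟨m ^ 2, by rintro _ ⟨G, -, rfl⟩; exact eCnt_le G⟩
  have hne : {k | ∃ G : SimpleGraph (Fin m), FFree F G ∧ eCnt G = k}.Nonempty := by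
    by_contra hcon
    rw [Set.not_nonempty_iff_eq_empty] at hcon
    rw [exNum, hcon] at hex
    simp at hex
    omega
  constructor
  · intro G hG
    rw [← hex]
    exact le_csSup hbdd ⟨G, hG, rfl⟩
  · rw [← hex]
    exact Nat.sSup_mem hne hbdd

end

section
open scoped Classical

lemma two_mul_eCnt_turanGraph_mul {r q : ℕ} (hr : 0 < r) :
    (2 * eCnt (turanGraph (r * q) r) : ℝ) = ((r * q : ℕ) : ℝ) ^ 2 - r * (q : ℝ) ^ 2 := by
  rw [two_mul_eCnt_turanGraph hr]
  have hdiv : r * q / r = q := Nat.mul_div_cancel_left q hr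
  have hle : ∀ i : Fin r, i ∈ Finset.univ →
      q ≤ (Finset.univ.filter fun v => turanPart (r * q) hr v = i).card := by
    intro i _
    rcases card_turanPart (n := r * q) hr i with h | h <;> rw [h, hdiv]
    exact Nat.le_succ _
  have hsum : ∑ _i : Fin r, q =
      ∑ i, (Finset.univ.filter fun v => turanPart (r * q) hr v = i).card := by
    rw [sum_card_part]; simp
  have heq := (Finset.sum_eq_sum_iff_of_le hle).1 hsum
  congr 1
  rw [Finset.sum_congr rfl fun i hi => by rw [← heq i hi]]
  simp

lemma FFree.comap {W : Type*} {m n : ℕ} {F : SimpleGraph W} {G : SimpleGraph (Fin n)}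
    (hG : FFree F G) (g : Fin m ↪ Fin n) : FFree F (G.comap g) := by
  rintro ⟨f, hf⟩
  exact hG ⟨⟨fun w => g (f w), fun h => f.map_adj h⟩, g.injective.comp hf⟩

/-- In an `F`-free graph, on a set meeting every class in exactly `q` vertices the ordered pairs
of adjacent vertices inside classes exceed the nonadjacent cross pairs by at most `2a`. -/
lemma card_inside_le {W : Type*} {r a q n : ℕ} (hr : 0 < r) {F : SimpleGraph W}
    (hq : ∀ G : SimpleGraph (Fin (r * q)), FFree F G → eCnt G ≤ eCnt (turanGraph (r * q) r) + a)
    {G : SimpleGraph (Fin n)} (hG : FFree F G) (p : Fin n → Fin r) (U : Finset (Fin n))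
    (hU : ∀ i, (U.filter fun v => p v = i).card = q) :
    (((U ×ˢ U).filter fun e => G.Adj e.1 e.2 ∧ p e.1 = p e.2).card : ℝ) ≤
      ((U ×ˢ U).filter fun e => ¬ G.Adj e.1 e.2 ∧ p e.1 ≠ p e.2).card + 2 * a := by
  have hcard : U.card = r * q := by
    rw [Finset.card_eq_sum_card_fiberwise (s := U) (t := Finset.univ) (f := p)
      (fun _ _ => Finset.mem_coe.2 (Finset.mem_univ _))]
    simp [hU]
  let e : Fin (r * q) ≃ U := (Fin.castOrderIso hcard.symm).toEquiv.trans U.equivFin.symm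
  let g : Fin (r * q) ↪ Fin n := e.toEmbedding.trans (Function.Embedding.subtype _)
  have htrans : ∀ f : Fin n → Fin n → ℝ, ∑ i, ∑ j, f (g i) (g j) = ∑ u ∈ U, ∑ v ∈ U, f u v := by
    intro f
    have h1 : ∀ h : Fin n → ℝ, ∑ i, h (g i) = ∑ u ∈ U, h u := by
      intro h
      rw [← Finset.sum_coe_sort U]
      exact Equiv.sum_comp e (fun u : U => h u)
    rw [h1 (fun u => ∑ j, f u (g j))]
    exact Finset.sum_congr rfl fun u _ => h1 _
  have hle := hq _ (hG.comap g)
  have hle' : (2 * eCnt (G.comap g) : ℝ) ≤ 2 * eCnt (turanGraph (r * q) r) + 2 * a := by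
    have : (eCnt (G.comap g) : ℝ) ≤ eCnt (turanGraph (r * q) r) + a := by exact_mod_cast hle
    linarith
  rw [two_mul_eCnt_turanGraph_mul hr, two_mul_eCnt] at hle'
  have h2 := htrans (fun u v => if G.Adj u v then (1 : ℝ) else 0)
  simp only [SimpleGraph.comap_adj] at hle'
  rw [h2] at hle'
  have hsame : ∑ u ∈ U, ∑ v ∈ U, (if p u = p v then (1 : ℝ) else 0) = r * (q : ℝ) ^ 2 := by
    have : ∀ u ∈ U, ∑ v ∈ U, (if p u = p v then (1 : ℝ) else 0) = q := by
      intro u _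
      rw [Finset.sum_boole, ← hU (p u)]
      simp only [eq_comm]
    rw [Finset.sum_congr rfl this, Finset.sum_const, hcard]
    simp; ring
  have hall : ∑ _u ∈ U, ∑ _v ∈ U, (1 : ℝ) = ((r * q : ℕ) : ℝ) ^ 2 := by
    simp [hcard]; ring
  have hin : (((U ×ˢ U).filter fun e => G.Adj e.1 e.2 ∧ p e.1 = p e.2).card : ℝ) =
      ∑ u ∈ U, ∑ v ∈ U, if G.Adj u v ∧ p u = p v then (1 : ℝ) else 0 := by
    rw [← Finset.sum_product' U U fun u v => if G.Adj u v ∧ p u = p v then (1 : ℝ) else 0,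
      Finset.sum_boole]
  have hms : (((U ×ˢ U).filter fun e => ¬ G.Adj e.1 e.2 ∧ p e.1 ≠ p e.2).card : ℝ) =
      ∑ u ∈ U, ∑ v ∈ U, if ¬ G.Adj u v ∧ p u ≠ p v then (1 : ℝ) else 0 := by
    rw [← Finset.sum_product' U U fun u v => if ¬ G.Adj u v ∧ p u ≠ p v then (1 : ℝ) else 0,
      Finset.sum_boole]
  have hid : ∑ u ∈ U, ∑ v ∈ U, (if G.Adj u v then (1 : ℝ) else 0) =
      ∑ _u ∈ U, ∑ _v ∈ U, (1 : ℝ) - ∑ u ∈ U, ∑ v ∈ U, (if p u = p v then (1 : ℝ) else 0)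
      + (∑ u ∈ U, ∑ v ∈ U, if G.Adj u v ∧ p u = p v then (1 : ℝ) else 0)
      - ∑ u ∈ U, ∑ v ∈ U, if ¬ G.Adj u v ∧ p u ≠ p v then (1 : ℝ) else 0 := by
    simp only [← Finset.sum_sub_distrib, ← Finset.sum_add_distrib]
    refine Finset.sum_congr rfl fun u _ => Finset.sum_congr rfl fun v _ => ?_
    by_cases h1 : G.Adj u v <;> by_cases h2 : p u = p v <;> simp [h1, h2]
  rw [hin, hms]
  rw [hid, hsame, hall] at hle'
  linarith

lemma HypStar.finite {W : Type*} {r a : ℕ} {F : SimpleGraph W} (hr : 2 ≤ r)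
    (h : HypStar r a F) : Finite W := by
  by_contra hW
  rw [not_finite_iff_infinite] at hW
  obtain ⟨m₀, hm₀⟩ := h.turan_number hr
  have hfree : ∀ m, FFree F (⊤ : SimpleGraph (Fin m)) := by
    rintro m ⟨f, hf⟩
    exact not_injective_infinite_finite f hf
  set q := m₀ + 2 * a + 2 with hqdef
  have hrq : m₀ ≤ r * q := by nlinarith
  have hle := (hm₀ (r * q) hrq).1 ⊤ (hfree _)
  have hle' : (2 * eCnt (⊤ : SimpleGraph (Fin (r * q))) : ℝ) ≤
      2 * eCnt (turanGraph (r * q) r) + 2 * a := by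
    have : (eCnt (⊤ : SimpleGraph (Fin (r * q))) : ℝ) ≤ eCnt (turanGraph (r * q) r) + a := by
      exact_mod_cast hle
    linarith
  rw [two_mul_eCnt_turanGraph_mul (by omega)] at hle'
  have htop : (2 * eCnt (⊤ : SimpleGraph (Fin (r * q))) : ℝ) =
      ((r * q : ℕ) : ℝ) ^ 2 - (r * q : ℕ) := by
    have h1 : (2 * eCnt (⊤ : SimpleGraph (Fin (r * q))) : ℝ) =
        ∑ u : Fin (r * q), ∑ v : Fin (r * q), (1 - if u = v then (1 : ℝ) else 0) := by
      rw [two_mul_eCnt]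
      refine Finset.sum_congr rfl fun u _ => Finset.sum_congr rfl fun v _ => ?_
      by_cases h : u = v <;> simp [h]
    rw [h1]
    simp only [Finset.sum_sub_distrib]
    simp; ring
  rw [htop] at hle'
  have hq' : (2 * a + 2 : ℝ) ≤ q := by rw [hqdef]; push_cast; linarith [Nat.cast_nonneg (α := ℝ) m₀]
  have hr' : (2 : ℝ) ≤ r := by exact_mod_cast hr
  have ha : (0 : ℝ) ≤ a := Nat.cast_nonneg _
  push_cast at hle'
  nlinarith [mul_le_mul hr' (show (2 * a + 1 : ℝ) ≤ q - 1 by linarith) (by linarith) (by linarith)]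

end

section
open scoped Classical

/-- The vertices in other classes to which `v` is not adjacent. -/
noncomputable def missing {n r : ℕ} (G : SimpleGraph (Fin n)) (p : Fin n → Fin r) (v : Fin n) :
    Finset (Fin n) :=
  Finset.univ.filter fun w => ¬ G.Adj v w ∧ p v ≠ p w

lemma mem_missing {n r : ℕ} {G : SimpleGraph (Fin n)} {p : Fin n → Fin r} {v w : Fin n} :
    w ∈ missing G p v ↔ ¬ G.Adj v w ∧ p v ≠ p w := by
  simp [missing]

/-- Greedy extension of a set without missing cross pairs to one meeting every class in exactly
`q` vertices. -/
lemma exists_cross_complete {n r q : ℕ} (G : SimpleGraph (Fin n)) (p : Fin n → Fin r)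
    (S₀ : Finset (Fin n)) (C : Fin r → Finset (Fin n)) (b : ℝ) (hb0 : 0 ≤ b)
    (hC : ∀ i, ∀ v ∈ C i, p v = i)
    (hb : ∀ i, ∀ v ∈ C i, ((missing G p v).card : ℝ) ≤ b)
    (hC0 : ∀ i, ∀ v ∈ C i, ∀ s ∈ S₀, p v ≠ p s → G.Adj v s)
    (hS0 : ∀ s ∈ S₀, ∀ t ∈ S₀, p s ≠ p t → G.Adj s t)
    (hcnt : ∀ i, (S₀.filter fun v => p v = i).card ≤ q)
    (hbig : ∀ i, r * q * (b + 1) < ((C i).card : ℝ)) :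
    ∃ S : Finset (Fin n), S₀ ⊆ S ∧ S ⊆ S₀ ∪ Finset.univ.biUnion C ∧
      (∀ s ∈ S, ∀ t ∈ S, p s ≠ p t → G.Adj s t) ∧
      ∀ i, (S.filter fun v => p v = i).card = q := by
  let P : Finset (Fin n) → Prop := fun S => S₀ ⊆ S ∧ S ⊆ S₀ ∪ Finset.univ.biUnion C ∧
      (∀ s ∈ S, ∀ t ∈ S, p s ≠ p t → G.Adj s t) ∧
      ∀ i, (S.filter fun v => p v = i).card ≤ q
  obtain ⟨S, hS, hmax⟩ := Finset.exists_max_image (Finset.univ.filter P) Finset.card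
    ⟨S₀, by simpa [P] using ⟨hS0, hcnt⟩⟩
  simp only [Finset.mem_filter, Finset.mem_univ, true_and] at hS hmax
  obtain ⟨h1, h2, h3, h4⟩ := hS
  refine ⟨S, h1, h2, h3, fun i => le_antisymm (h4 i) ?_⟩
  by_contra hlt
  push Not at hlt
  have hScard : S.card ≤ r * q := by
    rw [Finset.card_eq_sum_card_fiberwise (s := S) (t := Finset.univ) (f := p)
      (fun _ _ => Finset.mem_coe.2 (Finset.mem_univ _))]
    calc _ ≤ ∑ _i : Fin r, q := Finset.sum_le_sum fun i _ => h4 i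
      _ = r * q := by simp
  have hScard' : (S.card : ℝ) ≤ r * q := by exact_mod_cast hScard
  obtain ⟨v, hvC, hv⟩ : ∃ v ∈ C i, v ∉ S ∪ (S \ S₀).biUnion (missing G p) := by
    by_contra hcon
    push Not at hcon
    have hsub : C i ⊆ S ∪ (S \ S₀).biUnion (missing G p) := hcon
    have hc := Finset.card_le_card hsub
    have hc2 : ((S ∪ (S \ S₀).biUnion (missing G p)).card : ℝ) ≤ S.card + S.card * b := by
      have e1 : ((S ∪ (S \ S₀).biUnion (missing G p)).card : ℝ) ≤
          S.card + ((S \ S₀).biUnion (missing G p)).card := by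
        exact_mod_cast Finset.card_union_le _ _
      have e2 : (((S \ S₀).biUnion (missing G p)).card : ℝ) ≤
          ∑ s ∈ S \ S₀, ((missing G p s).card : ℝ) := by
        exact_mod_cast Finset.card_biUnion_le
      have e3 : ∑ s ∈ S \ S₀, ((missing G p s).card : ℝ) ≤ ∑ _s ∈ S \ S₀, b := by
        refine Finset.sum_le_sum fun s hs => ?_
        rw [Finset.mem_sdiff] at hs
        have := h2 hs.1
        simp only [Finset.mem_union, hs.2, false_or, Finset.mem_biUnion, Finset.mem_univ,
          true_and] at this
        obtain ⟨j, hj⟩ := this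
        exact hb j s hj
      have e4 : ((S \ S₀).card : ℝ) ≤ S.card := by
        exact_mod_cast Finset.card_le_card Finset.sdiff_subset
      rw [Finset.sum_const, nsmul_eq_mul] at e3
      nlinarith [mul_le_mul_of_nonneg_right e4 hb0]
    have hc' : ((C i).card : ℝ) ≤ ((S ∪ (S \ S₀).biUnion (missing G p)).card : ℝ) := by
      exact_mod_cast hc
    nlinarith [hbig i, mul_le_mul_of_nonneg_right hScard' (by linarith : (0 : ℝ) ≤ b + 1)]
  simp only [Finset.mem_union, Finset.mem_biUnion, Finset.mem_sdiff, not_or, not_exists,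
    not_and, mem_missing] at hv
  have hvadj : ∀ s ∈ S, p v ≠ p s → G.Adj v s := by
    intro s hs hne
    by_cases hs0 : s ∈ S₀
    · exact hC0 i v hvC s hs0 hne
    · by_contra hna
      exact hv.2 s ⟨hs, hs0⟩ (fun h => hna h.symm) hne.symm
  have hP : P (insert v S) := by
    refine ⟨h1.trans (Finset.subset_insert _ _), ?_, ?_, ?_⟩
    · intro s hs
      rcases Finset.mem_insert.1 hs with rfl | hs
      · exact Finset.mem_union_right _ (Finset.mem_biUnion.2 ⟨i, Finset.mem_univ _, hvC⟩)
      · exact h2 hs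
    · intro s hs t ht hne
      rcases Finset.mem_insert.1 hs with rfl | hs' <;>
        rcases Finset.mem_insert.1 ht with rfl | ht'
      · exact absurd rfl hne
      · exact hvadj t ht' hne
      · exact (hvadj s hs' hne.symm).symm
      · exact h3 s hs' t ht' hne
    · intro j
      rw [Finset.filter_insert]
      split_ifs with hj
      · rw [hC i v hvC] at hj
        subst hj
        exact (Finset.card_insert_le _ _).trans hlt
      · exact h4 j
  have := hmax _ hP
  rw [Finset.card_insert_of_notMem hv.1] at this
  omega

/-- The graph `G` with the neighbourhood of `u` replaced by `N`. -/
def replaceNbhd {n : ℕ} (G : SimpleGraph (Fin n)) (u : Fin n) (N : Finset (Fin n)) :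
    SimpleGraph (Fin n) :=
  SimpleGraph.fromRel fun x y => (x ≠ u ∧ y ≠ u ∧ G.Adj x y) ∨ (x = u ∧ y ∈ N)

lemma replaceNbhd_adj_of_ne {n : ℕ} {G : SimpleGraph (Fin n)} {u x y : Fin n}
    {N : Finset (Fin n)} (hx : x ≠ u) (hy : y ≠ u) :
    (replaceNbhd G u N).Adj x y ↔ G.Adj x y := by
  simp only [replaceNbhd, SimpleGraph.fromRel_adj, hx, hy, G.adj_comm y x]
  constructor
  · rintro ⟨-, h⟩; simpa [hx, hy] using h
  · intro h; exact ⟨h.ne, by simpa [hx, hy] using h⟩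

lemma replaceNbhd_adj_left {n : ℕ} {G : SimpleGraph (Fin n)} {u y : Fin n}
    {N : Finset (Fin n)} (hu : u ∉ N) : (replaceNbhd G u N).Adj u y ↔ y ∈ N := by
  simp only [replaceNbhd, SimpleGraph.fromRel_adj]
  constructor
  · rintro ⟨hne, h⟩; simpa [hne, hne.symm] using h
  · intro h; exact ⟨fun e => hu (e ▸ h), by simp [h]⟩

lemma FFree.replaceNbhd {W : Type*} [Fintype W] {n : ℕ} {F : SimpleGraph W}
    {G : SimpleGraph (Fin n)} (hG : FFree F G) (u : Fin n) (N V₁ : Finset (Fin n)) (hu : u ∉ N)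
    (b : ℝ) (hb0 : 0 ≤ b) (hN : ∀ v ∈ N, ((V₁.filter fun w => ¬ G.Adj v w).card : ℝ) ≤ b)
    (hbig : Fintype.card W * (b + 1) < (V₁.card : ℝ)) : FFree F (replaceNbhd G u N) := by
  rintro ⟨f, hf⟩
  let R : Finset (Fin n) := Finset.univ.image f
  have hR : (R.card : ℝ) ≤ Fintype.card W := by
    exact_mod_cast (Finset.card_image_le (s := Finset.univ) (f := f))
  obtain ⟨u', hu'V, hu'⟩ : ∃ u' ∈ V₁,
      u' ∉ R ∪ (R ∩ N).biUnion fun v => V₁.filter fun w => ¬ G.Adj v w := by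
    by_contra hcon
    push Not at hcon
    have hc := Finset.card_le_card (show V₁ ⊆ _ from hcon)
    have hc' : (V₁.card : ℝ) ≤ R.card +
        ∑ v ∈ R ∩ N, ((V₁.filter fun w => ¬ G.Adj v w).card : ℝ) := by
      refine (Nat.cast_le.2 (hc.trans (Finset.card_union_le _ _))).trans ?_
      push_cast
      gcongr
      exact_mod_cast Finset.card_biUnion_le
    have e3 : ∑ v ∈ R ∩ N, ((V₁.filter fun w => ¬ G.Adj v w).card : ℝ) ≤ ∑ _v ∈ R ∩ N, b :=
      Finset.sum_le_sum fun v hv => hN v (Finset.mem_inter.1 hv).2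
    have e4 : ((R ∩ N).card : ℝ) ≤ R.card := by
      exact_mod_cast Finset.card_le_card Finset.inter_subset_left
    rw [Finset.sum_const, nsmul_eq_mul] at e3
    nlinarith [mul_le_mul_of_nonneg_right e4 hb0,
      mul_le_mul_of_nonneg_right hR (by linarith : (0 : ℝ) ≤ b + 1)]
  simp only [Finset.mem_union, Finset.mem_biUnion, Finset.mem_inter, Finset.mem_filter, not_or,
    not_exists, not_and, not_not] at hu'
  have hRf : ∀ w, f w ∈ R := fun w => Finset.mem_image_of_mem _ (Finset.mem_univ _)
  let g : W → Fin n := fun w => if f w = u then u' else f w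
  apply hG
  refine ⟨⟨g, ?_⟩, ?_⟩
  · intro x y hxy
    have hadj := f.map_adj hxy
    by_cases hx : f x = u
    · have hy : f y ≠ u := fun h => hadj.ne (hx.trans h.symm)
      rw [hx, replaceNbhd_adj_left hu] at hadj
      simp only [g, hx, hy, if_true, if_false]
      exact (hu'.2 (f y) ⟨hRf y, hadj⟩ hu'V).symm
    · by_cases hy : f y = u
      · rw [hy, SimpleGraph.adj_comm, replaceNbhd_adj_left hu] at hadj
        simp only [g, hx, hy, if_true, if_false]
        exact hu'.2 (f x) ⟨hRf x, hadj⟩ hu'V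
      · rw [replaceNbhd_adj_of_ne hx hy] at hadj
        simpa only [g, hx, hy, if_false] using hadj
  · intro x y hxy
    by_cases hx : f x = u <;> by_cases hy : f y = u
    · exact hf (hx.trans hy.symm)
    · simp only [RelHom.coeFn_mk, g, hx, hy, if_true, if_false] at hxy
      exact absurd (hxy ▸ hRf y) hu'.1
    · simp only [RelHom.coeFn_mk, g, hx, hy, if_true, if_false] at hxy
      exact absurd (hxy ▸ hRf x) hu'.1
    · simp only [RelHom.coeFn_mk, g, hx, hy, if_false] at hxy
      exact hf hxy

/-- If replacing the neighbourhood of `u` by `N` does not increase the spectral radius, then the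
Perron weight of `N` is at most the weight of the neighbourhood of `u`. -/
lemma sum_le_of_specRad_replaceNbhd_le {n : ℕ} (G : SimpleGraph (Fin n)) (x : Fin n → ℝ)
    (hx : ∀ u, 0 ≤ x u) (hsum : ∑ u, x u ^ 2 = n) (hpos : 0 < specRad G)
    (heig : ∀ u, specRad G * x u = ∑ v, if G.Adj u v then x v else 0)
    (u : Fin n) (N : Finset (Fin n)) (hu : u ∉ N)
    (hle : specRad (replaceNbhd G u N) ≤ specRad G) : ∑ v ∈ N, x v ≤ specRad G * x u := by
  set x₀ : Fin n → ℝ := fun v => x v + if v = u then - x u else 0 with hx₀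
  have hx₀u : x₀ u = 0 := by simp [hx₀]
  have hx₀v : ∀ v, v ≠ u → x₀ v = x v := fun v hv => by simp [hx₀, hv]
  have hG₀ : adjForm G x₀ = specRad G * n - 2 * specRad G * x u ^ 2 := by
    rw [hx₀, adjForm_update_add, ← heig, adjForm_eq_sum_mul]
    simp only [← heig]
    rw [← hsum, Finset.mul_sum]
    have : ∑ v, x v * (specRad G * x v) = ∑ v, specRad G * x v ^ 2 :=
      Finset.sum_congr rfl fun v _ => by ring
    rw [this]; ring
  have hs₀ : ∑ v, x₀ v ^ 2 = n - x u ^ 2 := by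
    rw [hx₀, sum_sq_update_add, hsum]; ring
  have hG' : adjForm (replaceNbhd G u N) x₀ = adjForm G x₀ := by
    unfold adjForm
    refine Finset.sum_congr rfl fun v _ => Finset.sum_congr rfl fun w _ => ?_
    by_cases hv : v = u
    · subst hv; simp [hx₀u]
    · by_cases hw : w = u
      · subst hw; simp [hx₀u]
      · simp only [replaceNbhd_adj_of_ne hv hw]
  have hNsum : (∑ v, if (replaceNbhd G u N).Adj u v then x₀ v else 0) = ∑ v ∈ N, x v := by
    simp only [replaceNbhd_adj_left hu]
    rw [← Finset.sum_filter]
    have : (Finset.univ.filter fun v => v ∈ N) = N := by ext; simp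
    rw [this]
    exact Finset.sum_congr rfl fun v hv => hx₀v v fun h => hu (h ▸ hv)
  set σ := ∑ v ∈ N, x v with hσ
  have hσ0 : 0 ≤ σ := Finset.sum_nonneg fun v _ => hx v
  set lam := specRad G with hlam
  have h1 := adjForm_le_specRad (replaceNbhd G u N)
    (fun v => x₀ v + if v = u then σ / lam else 0)
  rw [adjForm_update_add, sum_sq_update_add, hNsum, hG', hG₀, hs₀, hx₀u] at h1
  have hn : 0 ≤ (n : ℝ) - x u ^ 2 + 2 * (σ / lam) * 0 + (σ / lam) ^ 2 := by
    have : 0 ≤ (n : ℝ) - x u ^ 2 := by rw [← hs₀]; positivity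
    have := sq_nonneg (σ / lam)
    linarith
  have h2 := h1.trans (mul_le_mul_of_nonneg_right hle hn)
  have h3 : lam * (σ / lam) = σ := by field_simp
  set y := σ / lam
  have h4 : lam * y ^ 2 ≤ lam * x u ^ 2 := by nlinarith
  have h5 : y ≤ x u := by
    have := le_of_mul_le_mul_left h4 hpos
    exact le_of_sq_le_sq this (hx u)
  rw [← h3]
  exact mul_le_mul_of_nonneg_left h5 hpos.le

end

section
open scoped Classical

/-- The ordered pairs of adjacent vertices in the same class. -/
noncomputable def insidePairs {n r : ℕ} (G : SimpleGraph (Fin n)) (p : Fin n → Fin r) :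
    Finset (Fin n × Fin n) :=
  Finset.univ.filter fun e => G.Adj e.1 e.2 ∧ p e.1 = p e.2

/-- The ordered pairs of nonadjacent vertices in distinct classes. -/
noncomputable def missingPairs {n r : ℕ} (G : SimpleGraph (Fin n)) (p : Fin n → Fin r) :
    Finset (Fin n × Fin n) :=
  Finset.univ.filter fun e => ¬ G.Adj e.1 e.2 ∧ p e.1 ≠ p e.2

lemma mem_insidePairs {n r : ℕ} {G : SimpleGraph (Fin n)} {p : Fin n → Fin r}
    {e : Fin n × Fin n} : e ∈ insidePairs G p ↔ G.Adj e.1 e.2 ∧ p e.1 = p e.2 := by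
  simp [insidePairs]

lemma mem_missingPairs {n r : ℕ} {G : SimpleGraph (Fin n)} {p : Fin n → Fin r}
    {e : Fin n × Fin n} : e ∈ missingPairs G p ↔ ¬ G.Adj e.1 e.2 ∧ p e.1 ≠ p e.2 := by
  simp [missingPairs]

lemma adjForm_decomp {n r : ℕ} (G : SimpleGraph (Fin n)) (p : Fin n → Fin r) (x : Fin n → ℝ) :
    adjForm G x = (∑ u, x u) ^ 2 - ∑ i, (∑ u with p u = i, x u) ^ 2
      + ∑ e ∈ insidePairs G p, x e.1 * x e.2 - ∑ e ∈ missingPairs G p, x e.1 * x e.2 := by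
  rw [← sum_ite_ne_part, insidePairs, missingPairs, Finset.sum_filter, Finset.sum_filter,
    Fintype.sum_prod_type, Fintype.sum_prod_type, adjForm]
  simp only [← Finset.sum_sub_distrib, ← Finset.sum_add_distrib]
  refine Finset.sum_congr rfl fun u _ => Finset.sum_congr rfl fun v _ => ?_
  by_cases h1 : G.Adj u v <;> by_cases h2 : p u = p v <;> simp [h1, h2]

/-- The edges of `G` inside the class `i`. -/
def insideGraph {n r : ℕ} (G : SimpleGraph (Fin n)) (p : Fin n → Fin r) (i : Fin r) :
    SimpleGraph (Fin n) :=
  G ⊓ SimpleGraph.fromRel fun u v => p u = i ∧ p v = i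

lemma insideGraph_adj {n r : ℕ} {G : SimpleGraph (Fin n)} {p : Fin n → Fin r} {i : Fin r}
    {u v : Fin n} : (insideGraph G p i).Adj u v ↔ G.Adj u v ∧ p u = i ∧ p v = i := by
  simp only [insideGraph, SimpleGraph.inf_adj, SimpleGraph.fromRel_adj]
  constructor
  · rintro ⟨h, -, h' | h'⟩
    · exact ⟨h, h'⟩
    · exact ⟨h, h'.symm⟩
  · rintro ⟨h, h'⟩; exact ⟨h, h.ne, Or.inl h'⟩

/-- The edges of `G` between distinct classes. -/
def crossGraph {n r : ℕ} (G : SimpleGraph (Fin n)) (p : Fin n → Fin r) : SimpleGraph (Fin n) :=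
  G ⊓ SimpleGraph.fromRel fun u v => p u ≠ p v

lemma crossGraph_adj {n r : ℕ} {G : SimpleGraph (Fin n)} {p : Fin n → Fin r}
    {u v : Fin n} : (crossGraph G p).Adj u v ↔ G.Adj u v ∧ p u ≠ p v := by
  simp only [crossGraph, SimpleGraph.inf_adj, SimpleGraph.fromRel_adj]
  constructor
  · rintro ⟨h, -, h' | h'⟩
    · exact ⟨h, h'⟩
    · exact ⟨h, h'.symm⟩
  · rintro ⟨h, h'⟩; exact ⟨h, h.ne, Or.inl h'⟩

lemma inCnt_eq {n r : ℕ} (G : SimpleGraph (Fin n)) (p : Fin n → Fin r) (i : Fin r) :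
    inCnt G p i = eCnt (insideGraph G p i) := by
  refine Nat.card_congr (Equiv.subtypeEquivRight ?_)
  intro e
  induction e with
  | _ u v =>
    simp [insideGraph_adj, Sym2.diag]

lemma crossCnt_eq {n r : ℕ} (G : SimpleGraph (Fin n)) (p : Fin n → Fin r) :
    crossCnt G p = eCnt (crossGraph G p) := by
  refine Nat.card_congr (Equiv.subtypeEquivRight ?_)
  intro e
  induction e with
  | _ u v =>
    simp [crossGraph_adj]

lemma two_mul_sum_inCnt {n r : ℕ} (G : SimpleGraph (Fin n)) (p : Fin n → Fin r) :
    2 * ∑ i, (inCnt G p i : ℝ) = (insidePairs G p).card := by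
  rw [Finset.mul_sum]
  simp only [inCnt_eq, two_mul_eCnt]
  rw [insidePairs, ← Finset.sum_boole, Fintype.sum_prod_type, Finset.sum_comm]
  refine Finset.sum_congr rfl fun u _ => ?_
  rw [Finset.sum_comm]
  refine Finset.sum_congr rfl fun v _ => ?_
  simp only [insideGraph_adj]
  by_cases h : G.Adj u v <;> by_cases h' : p u = p v
  · simp [h, h']
  · have : ∀ i, ¬ (p u = i ∧ p v = i) := fun i hi => h' (hi.1.trans hi.2.symm)
    simp [h, h', this]
  · simp [h]
  · simp [h]

lemma adjForm_one {n : ℕ} (G : SimpleGraph (Fin n)) : adjForm G (fun _ => 1) = 2 * eCnt G := by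
  rw [two_mul_eCnt]; simp [adjForm]

/-- In a maximum cut every vertex has at least as many neighbours in any class as in its own. -/
lemma card_nbrs_le_of_max_cut {n r : ℕ} {G : SimpleGraph (Fin n)} {p : Fin n → Fin r}
    (hmax : ∀ q : Fin n → Fin r, crossCnt G q ≤ crossCnt G p) (w : Fin n) (j : Fin r) :
    (Finset.univ.filter fun v => G.Adj w v ∧ p v = p w).card ≤
      (Finset.univ.filter fun v => G.Adj w v ∧ p v = j).card := by
  set q := Function.update p w j with hq
  have hqw : q w = j := by simp [hq]
  have hqv : ∀ v, v ≠ w → q v = p v := fun v hv => by simp [hq, hv]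
  have h := hmax q
  rw [crossCnt_eq, crossCnt_eq] at h
  have h' : adjForm (crossGraph G q) (fun _ => 1) ≤ adjForm (crossGraph G p) (fun _ => 1) := by
    rw [adjForm_one, adjForm_one]
    have : (eCnt (crossGraph G q) : ℝ) ≤ eCnt (crossGraph G p) := by exact_mod_cast h
    linarith
  have hpq := adjForm_update_add (crossGraph G q) (fun _ => 1) w (-1)
  have hpp := adjForm_update_add (crossGraph G p) (fun _ => 1) w (-1)
  have heq : adjForm (crossGraph G q) (fun u => 1 + if u = w then -1 else 0) =
      adjForm (crossGraph G p) (fun u => 1 + if u = w then -1 else 0) := by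
    unfold adjForm
    refine Finset.sum_congr rfl fun u _ => Finset.sum_congr rfl fun v _ => ?_
    by_cases hu : u = w
    · simp [hu]
    · by_cases hv : v = w
      · simp [hv]
      · simp only [crossGraph_adj, hqv u hu, hqv v hv]
  have key : ∀ i : Fin r, ∀ t : Fin n → Fin r, t w = i → (∀ v, v ≠ w → t v = p v) →
      (∑ v, if (crossGraph G t).Adj w v then (1 : ℝ) else 0) =
      (∑ v, if G.Adj w v then (1 : ℝ) else 0) -
        ((Finset.univ.filter fun v => G.Adj w v ∧ p v = i).card : ℝ) := by
    intro i t ht1 ht2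
    rw [← Finset.sum_boole, ← Finset.sum_sub_distrib]
    refine Finset.sum_congr rfl fun v _ => ?_
    simp only [crossGraph_adj]
    by_cases hv : v = w
    · subst hv; simp
    · rw [ht1, ht2 v hv]
      by_cases h1 : G.Adj w v <;> by_cases h2 : p v = i <;> simp [h1, h2, eq_comm]
      exact fun h => absurd h.symm h2
  have k1 := key j q hqw hqv
  have k2 := key (p w) p rfl fun _ _ => rfl
  have : ((Finset.univ.filter fun v => G.Adj w v ∧ p v = p w).card : ℝ) ≤
      ((Finset.univ.filter fun v => G.Adj w v ∧ p v = j).card : ℝ) := by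
    linarith
  exact_mod_cast this

end

section
open scoped Classical

/-- A nonnegative eigenvector for the spectral radius, normalised to squared length `n`. -/
structure IsPerron {n : ℕ} (G : SimpleGraph (Fin n)) (x : Fin n → ℝ) : Prop where
  nonneg : ∀ u, 0 ≤ x u
  sum_sq : ∑ u, x u ^ 2 = n
  eigen : ∀ u, specRad G * x u = ∑ v, if G.Adj u v then x v else 0

namespace IsPerron

variable {n r : ℕ} {G : SimpleGraph (Fin n)} {x : Fin n → ℝ}

lemma adjForm_eq (hx : IsPerron G x) : adjForm G x = specRad G * n := by
  rw [adjForm_eq_sum_mul, ← hx.sum_sq, Finset.mul_sum]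
  exact Finset.sum_congr rfl fun v _ => by rw [← hx.eigen]; ring

lemma sum_nonneg (hx : IsPerron G x) : 0 ≤ ∑ u, x u := Finset.sum_nonneg fun u _ => hx.nonneg u

lemma sum_le (hx : IsPerron G x) : ∑ u, x u ≤ n := by
  have h := sq_sum_le_card_mul_sum_sq (s := Finset.univ) (f := x)
  rw [hx.sum_sq, Finset.card_univ, Fintype.card_fin, ← sq] at h
  exact le_of_sq_le_sq h (Nat.cast_nonneg _)

lemma sum_sub_one_sq (hx : IsPerron G x) : ∑ u, (x u - 1) ^ 2 = 2 * n - 2 * ∑ u, x u := by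
  have : ∀ u, (x u - 1) ^ 2 = x u ^ 2 - 2 * x u + 1 := fun u => by ring
  simp only [this, Finset.sum_add_distrib, Finset.sum_sub_distrib, hx.sum_sq, ← Finset.mul_sum]
  simp; ring

lemma specRad_mul_le (hx : IsPerron G x) (u : Fin n) : specRad G * x u ≤ n := by
  rw [hx.eigen]
  refine le_trans (Finset.sum_le_sum fun v _ => ?_) hx.sum_le
  split_ifs
  · exact le_rfl
  · exact hx.nonneg v

lemma specRad_le (hx : IsPerron G x) (hn : 0 < n) : specRad G ≤ n := by
  have hn' : (0 : ℝ) < n := by exact_mod_cast hn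
  have h1 : adjForm G x ≤ ∑ u, x u * n := by
    rw [adjForm_eq_sum_mul]
    refine Finset.sum_le_sum fun u _ => mul_le_mul_of_nonneg_left ?_ (hx.nonneg u)
    rw [← hx.eigen]; exact hx.specRad_mul_le u
  rw [hx.adjForm_eq, ← Finset.sum_mul] at h1
  have := le_of_mul_le_mul_right h1 hn'
  exact this.trans hx.sum_le

lemma sum_part_sq_ge (p : Fin n → Fin r) (x : Fin n → ℝ) :
    (∑ u, x u) ^ 2 ≤ r * ∑ i, (∑ u with p u = i, x u) ^ 2 := by
  have h := sq_sum_le_card_mul_sum_sq (s := Finset.univ) (f := fun i : Fin r => ∑ u with p u = i, x u)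
  rw [Finset.card_univ, Fintype.card_fin, Finset.sum_fiberwise] at h
  exact h

/-- Both the weight of the missing pairs and the deviation of the Perron vector from the all-ones
vector are controlled by the weight of the inside pairs. -/
lemma missing_and_deviation_le (hx : IsPerron G x) (hr : 2 ≤ r) (hn : 0 < n) (p : Fin n → Fin r)
    (hlow : (1 - 1 / (r : ℝ)) * n ^ 2 - r / 4 ≤ specRad G * n) :
    ∑ e ∈ missingPairs G p, x e.1 * x e.2 ≤
      ∑ e ∈ insidePairs G p, x e.1 * x e.2 + r / 4 ∧
    n * ∑ u, (x u - 1) ^ 2 ≤ 4 * ∑ e ∈ insidePairs G p, x e.1 * x e.2 + r := by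
  have hr' : (2 : ℝ) ≤ r := by exact_mod_cast hr
  have hn' : (0 : ℝ) < n := by exact_mod_cast hn
  have hdec := adjForm_decomp G p x
  rw [hx.adjForm_eq] at hdec
  have hparts := sum_part_sq_ge p x
  have hS := hx.sum_le
  have hS0 := hx.sum_nonneg
  have hM0 : 0 ≤ ∑ e ∈ missingPairs G p, x e.1 * x e.2 :=
    Finset.sum_nonneg fun e _ => mul_nonneg (hx.nonneg _) (hx.nonneg _)
  have hI0 : 0 ≤ ∑ e ∈ insidePairs G p, x e.1 * x e.2 :=
    Finset.sum_nonneg fun e _ => mul_nonneg (hx.nonneg _) (hx.nonneg _)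
  rw [hx.sum_sub_one_sq]
  set S := ∑ u, x u
  set I := ∑ e ∈ insidePairs G p, x e.1 * x e.2
  set M := ∑ e ∈ missingPairs G p, x e.1 * x e.2
  set P := ∑ i, (∑ u with p u = i, x u) ^ 2
  have hrinv : 1 / (r : ℝ) ≤ 1 / 2 := one_div_le_one_div_of_le (by norm_num) hr'
  have hP : S ^ 2 * (1 / (r : ℝ)) ≤ P := by
    rw [mul_one_div, div_le_iff₀ (by linarith)]; linarith
  set ρ := 1 / (r : ℝ)
  have hSn : S ^ 2 ≤ n ^ 2 := pow_le_pow_left₀ hS0 hS 2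
  have hmain : (1 - ρ) * (n ^ 2 - S ^ 2) ≤ I + r / 4 - M := by nlinarith
  constructor
  · nlinarith [mul_nonneg (by linarith : (0 : ℝ) ≤ 1 - ρ) (sub_nonneg.2 hSn)]
  · have h1 : (1 / 2 : ℝ) * (n ^ 2 - S ^ 2) ≤ (1 - ρ) * (n ^ 2 - S ^ 2) :=
      mul_le_mul_of_nonneg_right (by linarith) (sub_nonneg.2 hSn)
    nlinarith [mul_nonneg hS0 (sub_nonneg.2 hS)]

lemma sum_insidePairs_sq_le (hx : IsPerron G x) (p : Fin n → Fin r) :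
    (∑ e ∈ insidePairs G p, x e.1 * x e.2) ^ 2 ≤ (insidePairs G p).card * (n : ℝ) ^ 2 := by
  refine (sq_sum_le_card_mul_sum_sq).trans ?_
  refine mul_le_mul_of_nonneg_left ?_ (Nat.cast_nonneg _)
  calc ∑ e ∈ insidePairs G p, (x e.1 * x e.2) ^ 2
      ≤ ∑ e : Fin n × Fin n, (x e.1 * x e.2) ^ 2 :=
        Finset.sum_le_sum_of_subset_of_nonneg (Finset.subset_univ _) fun _ _ _ => sq_nonneg _
    _ = ∑ u, ∑ v, x u ^ 2 * x v ^ 2 := by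
        rw [Fintype.sum_prod_type]
        exact Finset.sum_congr rfl fun u _ => Finset.sum_congr rfl fun v _ => by ring
    _ = (n : ℝ) ^ 2 := by rw [← Finset.sum_mul_sum, hx.sum_sq, sq]

lemma abs_deviation_sq_le (x : Fin n → ℝ) :
    (∑ u, |x u - 1|) ^ 2 ≤ n * ∑ u, (x u - 1) ^ 2 := by
  have h := sq_sum_le_card_mul_sum_sq (s := Finset.univ) (f := fun u => |x u - 1|)
  simpa using h

lemma sum_ge_card_sub (N : Finset (Fin n)) (x : Fin n → ℝ) :
    (N.card : ℝ) - ∑ u, |x u - 1| ≤ ∑ v ∈ N, x v := by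
  have h1 : ∑ v ∈ N, |x v - 1| ≤ ∑ u, |x u - 1| :=
    Finset.sum_le_sum_of_subset_of_nonneg (Finset.subset_univ _) fun _ _ _ => abs_nonneg _
  have h2 : ∑ v ∈ N, (1 - |x v - 1|) ≤ ∑ v ∈ N, x v :=
    Finset.sum_le_sum fun v _ => by linarith [neg_abs_le (x v - 1)]
  rw [Finset.sum_sub_distrib] at h2
  simp at h2
  linarith

lemma sum_le_card_add (N : Finset (Fin n)) (x : Fin n → ℝ) :
    ∑ v ∈ N, x v ≤ (N.card : ℝ) + ∑ u, |x u - 1| := by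
  have h1 : ∑ v ∈ N, |x v - 1| ≤ ∑ u, |x u - 1| :=
    Finset.sum_le_sum_of_subset_of_nonneg (Finset.subset_univ _) fun _ _ _ => abs_nonneg _
  have h2 : ∑ v ∈ N, x v ≤ ∑ v ∈ N, (1 + |x v - 1|) :=
    Finset.sum_le_sum fun v _ => by linarith [le_abs_self (x v - 1)]
  rw [Finset.sum_add_distrib] at h2
  simp at h2
  linarith

/-- Few vertices have a small Perron entry, so few pairs are missing. -/
lemma card_missingPairs_le (hx : IsPerron G x) (p : Fin n → Fin r) :
    ((missingPairs G p).card : ℝ) ≤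
      4 * ∑ e ∈ missingPairs G p, x e.1 * x e.2 + 8 * (n * ∑ u, (x u - 1) ^ 2) := by
  have hpt : ∀ e : Fin n × Fin n,
      (1 : ℝ) ≤ 4 * (x e.1 * x e.2) + (4 * (x e.1 - 1) ^ 2 + 4 * (x e.2 - 1) ^ 2) := by
    intro e
    have h1 := hx.nonneg e.1
    have h2 := hx.nonneg e.2
    nlinarith [sq_nonneg (x e.1 + x e.2 - 1), mul_nonneg h1 h2]
  have h1 : ((missingPairs G p).card : ℝ) ≤ ∑ e ∈ missingPairs G p,
      (4 * (x e.1 * x e.2) + (4 * (x e.1 - 1) ^ 2 + 4 * (x e.2 - 1) ^ 2)) := by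
    have : ((missingPairs G p).card : ℝ) = ∑ _e ∈ missingPairs G p, (1 : ℝ) := by simp
    rw [this]
    exact Finset.sum_le_sum fun e _ => hpt e
  rw [Finset.sum_add_distrib, ← Finset.mul_sum] at h1
  have h2 : ∑ e ∈ missingPairs G p, (4 * (x e.1 - 1) ^ 2 + 4 * (x e.2 - 1) ^ 2) ≤
      ∑ e : Fin n × Fin n, (4 * (x e.1 - 1) ^ 2 + 4 * (x e.2 - 1) ^ 2) :=
    Finset.sum_le_sum_of_subset_of_nonneg (Finset.subset_univ _) fun _ _ _ => by positivity
  have h3 : ∑ e : Fin n × Fin n, (4 * (x e.1 - 1) ^ 2 + 4 * (x e.2 - 1) ^ 2) =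
      8 * ((n : ℝ) * ∑ u, (x u - 1) ^ 2) := by
    rw [Fintype.sum_prod_type]
    simp only [Finset.sum_add_distrib, Finset.sum_const, Finset.card_univ, Fintype.card_fin,
      nsmul_eq_mul, ← Finset.mul_sum]
    ring
  linarith

end IsPerron

lemma card_missingPairs_eq {n r : ℕ} (G : SimpleGraph (Fin n)) (p : Fin n → Fin r) :
    (missingPairs G p).card = ∑ v, (missing G p v).card := by
  rw [missingPairs, Finset.card_filter, Fintype.sum_prod_type]
  refine Finset.sum_congr rfl fun u _ => ?_
  rw [missing, Finset.card_filter]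

/-- Markov's inequality for the number of missing cross neighbours. -/
lemma card_atypical_mul_le {n r : ℕ} (G : SimpleGraph (Fin n)) (p : Fin n → Fin r) (b : ℝ) :
    ((Finset.univ.filter fun v => b < ((missing G p v).card : ℝ)).card : ℝ) * b ≤
      (missingPairs G p).card := by
  rw [card_missingPairs_eq]
  push_cast
  calc _ = ∑ _v ∈ Finset.univ.filter fun v => b < ((missing G p v).card : ℝ), b := by simp
    _ ≤ ∑ v ∈ Finset.univ.filter fun v => b < ((missing G p v).card : ℝ),
        ((missing G p v).card : ℝ) :=
      Finset.sum_le_sum fun v hv => (Finset.mem_filter.1 hv).2.le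
    _ ≤ _ := Finset.sum_le_sum_of_subset_of_nonneg (Finset.subset_univ _)
      fun _ _ _ => Nat.cast_nonneg _

end

section
open scoped Classical

lemma sum_sq_add_two_le {r q : ℕ} (t m : Fin r → ℕ) (ht : ∀ i, t i = q ∨ t i = q + 1)
    (hsum : ∑ i, t i = ∑ i, m i) {i j : Fin r} (hij : m i + 2 ≤ m j) :
    ∑ k, (t k : ℝ) ^ 2 + 2 ≤ ∑ k, (m k : ℝ) ^ 2 := by
  have key : ∑ k, (t k : ℤ) ^ 2 + 2 ≤ ∑ k, (m k : ℤ) ^ 2 := by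
    have hnn : ∀ k, 0 ≤ ((m k : ℤ) - q) * (m k - q - 1) := by
      intro k
      rcases le_or_gt (m k : ℤ) q with h | h
      · exact mul_nonneg_of_nonpos_of_nonpos (by omega) (by omega)
      · exact mul_nonneg (by omega) (by omega)
    obtain ⟨k, hk⟩ : ∃ k, 2 ≤ ((m k : ℤ) - q) * (m k - q - 1) := by
      rcases lt_or_ge (m i) q with h | h
      · exact ⟨i, by nlinarith [(by omega : (m i : ℤ) + 1 ≤ q)]⟩
      · exact ⟨j, by nlinarith [(by omega : (q : ℤ) + 2 ≤ m j)]⟩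
    have hm := hk.trans (Finset.single_le_sum (f := fun k => ((m k : ℤ) - q) * (m k - q - 1))
      (fun k _ => hnn k) (Finset.mem_univ k))
    have ht0 : ∑ k, ((t k : ℤ) - q) * (t k - q - 1) = 0 := by
      refine Finset.sum_eq_zero fun k _ => ?_
      rcases ht k with h | h <;> simp [h]
    have hexp : ∀ z : ℤ, (z - q) * (z - q - 1) = z ^ 2 - (2 * q + 1) * z + q * (q + 1) :=
      fun z => by ring
    simp only [hexp, Finset.sum_add_distrib, Finset.sum_sub_distrib, ← Finset.mul_sum] at hm ht0
    have hs : ∑ k, (t k : ℤ) = ∑ k, (m k : ℤ) := by exact_mod_cast hsum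
    rw [hs] at ht0
    linarith
  exact_mod_cast key

lemma sum_sq_le_of_balanced {r q : ℕ} (hr : 0 < r) (t : Fin r → ℕ)
    (ht : ∀ i, t i = q ∨ t i = q + 1) :
    ∑ k, (t k : ℝ) ^ 2 ≤ (∑ k, (t k : ℝ)) ^ 2 * (1 / r) + r / 4 := by
  have ht0 : ∑ k, ((t k : ℝ) - q) * (t k - q - 1) = 0 := by
    refine Finset.sum_eq_zero fun k _ => ?_
    rcases ht k with h | h <;> simp [h]
  have hexp : ∀ z : ℝ, (z - q) * (z - q - 1) = z ^ 2 - (2 * q + 1) * z + q * (q + 1) :=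
    fun z => by ring
  simp only [hexp, Finset.sum_add_distrib, Finset.sum_sub_distrib, ← Finset.mul_sum,
    Finset.sum_const, Finset.card_univ, Fintype.card_fin, nsmul_eq_mul] at ht0
  have hr' : (0 : ℝ) < r := by exact_mod_cast hr
  set s := ∑ k, (t k : ℝ)
  have h : (0 : ℝ) ≤ (s - r * (q + 1 / 2)) ^ 2 * (1 / r) := by positivity
  have h2 : (s - r * (q + 1 / 2)) ^ 2 * (1 / r) =
      s ^ 2 * (1 / r) - (2 * q + 1) * s + r * (q * (q + 1)) + r / 4 := by
    field_simp; ring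
  linarith

lemma partSize_eq {n r : ℕ} (p : Fin n → Fin r) (i : Fin r) :
    partSize p i = (Finset.univ.filter fun v => p v = i).card := by
  rw [partSize, Nat.card_eq_fintype_card, Fintype.card_subtype]

/-- The spectral radius of a spectral-extremal graph is at least the average degree of an
edge-extremal one. -/
lemma SpecExtremal.specRad_mul_ge {W : Type*} {r a n : ℕ} (hr : 0 < r) {F : SimpleGraph W}
    {G : SimpleGraph (Fin n)} (hG : SpecExtremal F G)
    (hT : ∃ T : SimpleGraph (Fin n), FFree F T ∧ eCnt T = eCnt (turanGraph n r) + a) :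
    ∃ (q : ℕ) (t : Fin r → ℕ), (∀ i, t i = q ∨ t i = q + 1) ∧ ∑ i, t i = n ∧
      (n : ℝ) ^ 2 - ∑ i, (t i : ℝ) ^ 2 + 2 * a ≤ specRad G * n := by
  obtain ⟨T, hT, hcnt⟩ := hT
  refine ⟨n / r, fun i => (Finset.univ.filter fun v => turanPart n hr v = i).card,
    card_turanPart hr, sum_card_part _, ?_⟩
  have h1 := adjForm_le_specRad T (fun _ => 1)
  rw [adjForm_one, hcnt] at h1
  push_cast at h1
  rw [mul_add, two_mul_eCnt_turanGraph hr] at h1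
  simp only [one_pow, Finset.sum_const, Finset.card_univ, Fintype.card_fin, nsmul_eq_mul,
    mul_one] at h1
  exact h1.trans (mul_le_mul_of_nonneg_right (hG.2 T hT) (Nat.cast_nonneg _))

end

section
open scoped Classical

namespace IsPerron

variable {n r : ℕ} {G : SimpleGraph (Fin n)} {x : Fin n → ℝ} {p : Fin n → Fin r}

/-- If few pairs are inside the classes, then few pairs are missing and the Perron vector is close
to the all-ones vector. -/
lemma rough_estimates (hx : IsPerron G x) (hr : 2 ≤ r) (hn : 0 < n)
    (hlow : (1 - 1 / (r : ℝ)) * n ^ 2 - r / 4 ≤ specRad G * n) {τ : ℝ} (hτ : 0 < τ)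
    (hin : ((insidePairs G p).card : ℝ) ≤ 2 * τ ^ 4 * n ^ 2) (hrn : (r : ℝ) ≤ τ ^ 2 * n ^ 2) :
    ((Finset.univ.filter fun v => 10 * τ * n < ((missing G p v).card : ℝ)).card : ℝ)
      ≤ 10 * τ * n ∧ ∑ u, |x u - 1| ≤ 3 * τ * n := by
  have hn' : (0 : ℝ) < n := by exact_mod_cast hn
  obtain ⟨hM, hQ⟩ := hx.missing_and_deviation_le hr hn p hlow
  have hmiss := hx.card_missingPairs_le p
  have hI : ∑ e ∈ insidePairs G p, x e.1 * x e.2 ≤ 2 * τ ^ 2 * n ^ 2 := by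
    refine le_of_sq_le_sq ((hx.sum_insidePairs_sq_le p).trans ?_) (by positivity)
    have h := mul_le_mul_of_nonneg_right hin (sq_nonneg (n : ℝ))
    have h' : (0 : ℝ) ≤ τ ^ 4 * n ^ 4 := by positivity
    nlinarith
  have hQ' : n * ∑ u, (x u - 1) ^ 2 ≤ 9 * (τ ^ 2 * n ^ 2) := by linarith
  constructor
  · have h := card_atypical_mul_le G p (10 * τ * n)
    have h' : (((Finset.univ.filter fun v => 10 * τ * n < ((missing G p v).card : ℝ)).card : ℝ)) *
        (10 * τ * n) ≤ (10 * τ * n) * (10 * τ * n) := by nlinarith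
    exact le_of_mul_le_mul_right h' (by positivity)
  · refine le_of_sq_le_sq ((abs_deviation_sq_le x).trans ?_) (by positivity)
    linarith

/-- Every Perron entry is large, since otherwise the neighbourhood of the vertex could be replaced
by the typical vertices of the other classes. -/
lemma specRad_mul_ge {W : Type*} [Fintype W] {F : SimpleGraph W} (hx : IsPerron G x)
    (hG : SpecExtremal F G) (hpos : 0 < specRad G) {τ : ℝ} (hτ : 0 ≤ τ) (hτ1 : τ ≤ 1)
    (hatyp : ((Finset.univ.filter fun v => 10 * τ * n < ((missing G p v).card : ℝ)).card : ℝ)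
      ≤ 10 * τ * n) (hdev : ∑ u, |x u - 1| ≤ 3 * τ * n)
    (hup : ∀ i, ((Finset.univ.filter fun v => p v = i).card : ℝ) ≤ (1 / r + 3 * τ ^ 2) * n)
    (hbig : ∀ i, (Fintype.card W : ℝ) * (10 * τ * n + 1) <
      (Finset.univ.filter fun v => p v = i).card) (u : Fin n) :
    (1 - 1 / (r : ℝ) - 16 * τ) * n ≤ specRad G * x u := by
  set N : Finset (Fin n) := Finset.univ.filter fun v =>
    p v ≠ p u ∧ ((missing G p v).card : ℝ) ≤ 10 * τ * n with hN
  have huN : u ∉ N := by simp [hN]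
  have hfree : FFree F (replaceNbhd G u N) := by
    refine hG.1.replaceNbhd u N (Finset.univ.filter fun v => p v = p u) huN (10 * τ * n)
      (by positivity) (fun v hv => ?_) (hbig _)
    rw [hN, Finset.mem_filter] at hv
    refine le_trans ?_ hv.2.2
    refine Nat.cast_le.2 (Finset.card_le_card fun w hw => ?_)
    simp only [Finset.mem_filter, Finset.mem_univ, true_and] at hw
    exact mem_missing.2 ⟨hw.2, fun e => hv.2.1 (e.trans hw.1)⟩
  have h1 := sum_le_of_specRad_replaceNbhd_le G x hx.nonneg hx.sum_sq hpos hx.eigen u N huN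
    (hG.2 _ hfree)
  have h2 := sum_ge_card_sub N x
  have hcover : (Finset.univ : Finset (Fin n)) ⊆ N ∪ ((Finset.univ.filter fun v => p v = p u) ∪
      Finset.univ.filter fun v => 10 * τ * n < ((missing G p v).card : ℝ)) := by
    intro v _
    simp only [hN, Finset.mem_union, Finset.mem_filter, Finset.mem_univ, true_and]
    by_cases h : p v = p u
    · exact Or.inr (Or.inl h)
    · rcases le_or_gt ((missing G p v).card : ℝ) (10 * τ * n) with h' | h'
      · exact Or.inl ⟨h, h'⟩
      · exact Or.inr (Or.inr h')
  have hc := (Finset.card_le_card hcover).trans ((Finset.card_union_le _ _).trans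
    (Nat.add_le_add_left (Finset.card_union_le _ _) _))
  rw [Finset.card_univ, Fintype.card_fin] at hc
  have hc' : (n : ℝ) ≤ N.card + ((Finset.univ.filter fun v => p v = p u).card +
    (Finset.univ.filter fun v => 10 * τ * n < ((missing G p v).card : ℝ)).card) := by
    exact_mod_cast hc
  have hu := hup (p u)
  have hτ2 : τ ^ 2 * n ≤ τ * n := mul_le_mul_of_nonneg_right (by nlinarith) (Nat.cast_nonneg _)
  nlinarith

lemma card_nbrs_ge (hx : IsPerron G x) {τ : ℝ} (hdev : ∑ u, |x u - 1| ≤ 3 * τ * n) (u : Fin n)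
    (hu : (1 - 1 / (r : ℝ) - 16 * τ) * n ≤ specRad G * x u) :
    (1 - 1 / (r : ℝ) - 19 * τ) * n ≤ (Finset.univ.filter fun v => G.Adj u v).card := by
  have h := sum_le_card_add (Finset.univ.filter fun v => G.Adj u v) x
  rw [Finset.sum_filter, ← hx.eigen] at h
  linarith

end IsPerron

variable {n r : ℕ} {G : SimpleGraph (Fin n)} {p : Fin n → Fin r}

lemma card_inside_le_of_cross_complete {W : Type*} {a q : ℕ} (hr : 0 < r) {F : SimpleGraph W}
    (hq : ∀ G : SimpleGraph (Fin (r * q)), FFree F G → eCnt G ≤ eCnt (turanGraph (r * q) r) + a)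
    (hG : FFree F G) (U : Finset (Fin n))
    (hU : ∀ i, (U.filter fun v => p v = i).card = q)
    (hcross : ∀ s ∈ U, ∀ t ∈ U, p s ≠ p t → G.Adj s t) :
    ((U ×ˢ U).filter fun e => G.Adj e.1 e.2 ∧ p e.1 = p e.2).card ≤ 2 * a := by
  have h := card_inside_le hr hq hG p U hU
  have h0 : ((U ×ˢ U).filter fun e => ¬ G.Adj e.1 e.2 ∧ p e.1 ≠ p e.2) = ∅ := by
    refine Finset.filter_eq_empty_iff.2 fun e he => ?_
    rw [Finset.mem_product] at he
    exact fun h => h.1 (hcross _ he.1 _ he.2 h.2)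
  rw [h0] at h
  simp only [Finset.card_empty, Nat.cast_zero, zero_add] at h
  exact_mod_cast h

/-- No vertex has many neighbours in its own class of a maximum cut. -/
lemma card_own_nbrs_lt {W : Type*} {a q : ℕ} (hr : 0 < r) {F : SimpleGraph W}
    (hq : ∀ G : SimpleGraph (Fin (r * q)), FFree F G → eCnt G ≤ eCnt (turanGraph (r * q) r) + a)
    (hqa : 2 * a + 2 ≤ q) (hG : FFree F G)
    (hmax : ∀ p' : Fin n → Fin r, crossCnt G p' ≤ crossCnt G p) {τ : ℝ} (hτ : 0 ≤ τ)
    (hatyp : ((Finset.univ.filter fun v => 10 * τ * n < ((missing G p v).card : ℝ)).card : ℝ)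
      ≤ 10 * τ * n) (hrq : (r : ℝ) * q < τ * n) (w : Fin n) :
    ((Finset.univ.filter fun v => G.Adj w v ∧ p v = p w).card : ℝ) <
      (10 * r * q + 11) * τ * n := by
  by_contra hcon
  push Not at hcon
  set C : Fin r → Finset (Fin n) := fun j => Finset.univ.filter fun v =>
    (G.Adj w v ∧ p v = j) ∧ ((missing G p v).card : ℝ) ≤ 10 * τ * n with hC
  have hmemC : ∀ j v, v ∈ C j ↔ (G.Adj w v ∧ p v = j) ∧
      ((missing G p v).card : ℝ) ≤ 10 * τ * n := fun j v => by simp [hC]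
  have hCcard : ∀ j, r * q * (10 * τ * n + 1) < ((C j).card : ℝ) := by
    intro j
    have hcover : (Finset.univ.filter fun v => G.Adj w v ∧ p v = j) ⊆ C j ∪
        Finset.univ.filter fun v => 10 * τ * n < ((missing G p v).card : ℝ) := by
      intro v hv
      rw [Finset.mem_union, hmemC]
      simp only [Finset.mem_filter, Finset.mem_univ, true_and] at hv ⊢
      rcases le_or_gt ((missing G p v).card : ℝ) (10 * τ * n) with h' | h'
      · exact Or.inl ⟨hv, h'⟩
      · exact Or.inr h'
    have hc := (card_nbrs_le_of_max_cut hmax w j).trans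
      ((Finset.card_le_card hcover).trans (Finset.card_union_le _ _))
    have hc' : ((Finset.univ.filter fun v => G.Adj w v ∧ p v = p w).card : ℝ) ≤ (C j).card +
      (Finset.univ.filter fun v => 10 * τ * n < ((missing G p v).card : ℝ)).card := by
      exact_mod_cast hc
    nlinarith
  obtain ⟨S, hwS, hSsub, hcross, hScnt⟩ := exists_cross_complete (q := q) G p {w} C (10 * τ * n)
    (by positivity) (fun j v hv => ((hmemC j v).1 hv).1.2) (fun j v hv => ((hmemC j v).1 hv).2)
    (fun j v hv s hs _ => by
      rw [Finset.mem_singleton.1 hs]; exact ((hmemC j v).1 hv).1.1.symm)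
    (fun s hs t ht hne => by
      rw [Finset.mem_singleton.1 hs, Finset.mem_singleton.1 ht] at hne; exact absurd rfl hne)
    (fun i => (Finset.card_filter_le _ _).trans (by simp; omega)) hCcard
  have hle := card_inside_le_of_cross_complete hr hq hG S hScnt hcross
  have hge : q - 1 ≤ ((S ×ˢ S).filter fun e => G.Adj e.1 e.2 ∧ p e.1 = p e.2).card := by
    have hmem : w ∈ S.filter fun v => p v = p w :=
      Finset.mem_filter.2 ⟨hwS (Finset.mem_singleton_self w), rfl⟩
    rw [← hScnt (p w), ← Finset.card_erase_of_mem hmem]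
    refine Finset.card_le_card_of_injOn (fun v => (w, v)) (fun v hv => ?_)
      (fun v _ v' _ h => (Prod.mk.inj h).2)
    simp only [Finset.coe_erase, Finset.coe_filter, Set.mem_sdiff, Set.mem_ofPred_eq,
      Set.mem_singleton_iff] at hv
    obtain ⟨⟨hvS, hpv⟩, hvw⟩ := hv
    have hadj : G.Adj w v := by
      rcases Finset.mem_union.1 (hSsub hvS) with h | h
      · exact absurd (Finset.mem_singleton.1 h) hvw
      · obtain ⟨j, -, hj⟩ := Finset.mem_biUnion.1 h
        exact ((hmemC j v).1 hj).1.1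
    simp [hwS (Finset.mem_singleton_self w), hvS, hadj, hpv]
  omega

lemma card_missing_le {β γ σ η : ℝ} (w : Fin n)
    (hdeg : (1 - 1 / (r : ℝ) - η) * n ≤ (Finset.univ.filter fun v => G.Adj w v).card)
    (hown : ((Finset.univ.filter fun v => G.Adj w v ∧ p v = p w).card : ℝ) ≤ γ * n)
    (hlo : (1 / (r : ℝ) - σ) * n ≤ (Finset.univ.filter fun v => p v = p w).card)
    (hβ : (η + γ + σ) ≤ β) : ((missing G p w).card : ℝ) ≤ β * n := by
  have hsplit : (missing G p w).card + (Finset.univ.filter fun v => G.Adj w v).card +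
      (Finset.univ.filter fun v => p v = p w).card =
      n + (Finset.univ.filter fun v => G.Adj w v ∧ p v = p w).card := by
    have hn : ∀ m, n + m = ∑ _v : Fin n, 1 + m := by simp
    rw [hn]
    simp only [missing, Finset.card_filter, ← Finset.sum_add_distrib]
    refine Finset.sum_congr rfl fun v _ => ?_
    by_cases h1 : G.Adj w v <;> by_cases h2 : p v = p w <;> simp [h1, h2, eq_comm]
    simp [Ne.symm h2]
  have hs : ((missing G p w).card : ℝ) + (Finset.univ.filter fun v => G.Adj w v).card +
      (Finset.univ.filter fun v => p v = p w).card =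
      n + (Finset.univ.filter fun v => G.Adj w v ∧ p v = p w).card := by exact_mod_cast hsplit
  have := mul_le_mul_of_nonneg_right hβ (Nat.cast_nonneg (α := ℝ) n)
  nlinarith

end

section
open scoped Classical

variable {n r : ℕ} {G : SimpleGraph (Fin n)} {p : Fin n → Fin r}

/-- The endpoints of a set of pairs. -/
def endpoints (P : Finset (Fin n × Fin n)) : Finset (Fin n) :=
  P.image Prod.fst ∪ P.image Prod.snd

lemma fst_mem_endpoints {P : Finset (Fin n × Fin n)} {e : Fin n × Fin n} (he : e ∈ P) :
    e.1 ∈ endpoints P := Finset.mem_union_left _ (Finset.mem_image_of_mem _ he)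

lemma snd_mem_endpoints {P : Finset (Fin n × Fin n)} {e : Fin n × Fin n} (he : e ∈ P) :
    e.2 ∈ endpoints P := Finset.mem_union_right _ (Finset.mem_image_of_mem _ he)

lemma card_endpoints_le (P : Finset (Fin n × Fin n)) : (endpoints P).card ≤ 2 * P.card := by
  have h1 : (P.image Prod.fst).card ≤ P.card := Finset.card_image_le
  have h2 : (P.image Prod.snd).card ≤ P.card := Finset.card_image_le
  have h3 := Finset.card_union_le (P.image Prod.fst) (P.image Prod.snd)
  rw [endpoints]; omega

/-- If every vertex misses few vertices of the other classes, then every class spans few edges. -/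
lemma card_insidePairs_le_of_missing_le {W : Type*} {a q : ℕ} (hr : 0 < r) {F : SimpleGraph W}
    (hq : ∀ G : SimpleGraph (Fin (r * q)), FFree F G → eCnt G ≤ eCnt (turanGraph (r * q) r) + a)
    (hqa : 4 * a + 2 ≤ q) (hG : FFree F G) {b : ℝ} (hb0 : 0 ≤ b)
    (hb : ∀ w, ((missing G p w).card : ℝ) ≤ b)
    (hbig : ∀ i, (4 * a + 2) * b + r * q * (b + 1) <
      ((Finset.univ.filter fun v => p v = i).card : ℝ)) :
    (insidePairs G p).card ≤ r * (2 * a) := by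
  suffices h : ∀ i, ((insidePairs G p).filter fun e => p e.1 = i).card ≤ 2 * a by
    rw [Finset.card_eq_sum_card_fiberwise (s := insidePairs G p) (t := Finset.univ)
      (f := fun e => p e.1) (fun _ _ => Finset.mem_coe.2 (Finset.mem_univ _))]
    refine (Finset.sum_le_sum fun i _ => h i).trans ?_
    simp
  intro i
  by_contra hcon
  obtain ⟨P, hPsub, hPcard⟩ := Finset.exists_subset_card_eq
    (show 2 * a + 1 ≤ ((insidePairs G p).filter fun e => p e.1 = i).card by omega)
  have hP : ∀ e ∈ P, (G.Adj e.1 e.2 ∧ p e.1 = p e.2) ∧ p e.1 = i := fun e he => by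
    obtain ⟨h1, h2⟩ := Finset.mem_filter.1 (hPsub he)
    exact ⟨mem_insidePairs.1 h1, h2⟩
  set U := endpoints P with hU
  have hUcard : U.card ≤ 4 * a + 2 := (card_endpoints_le P).trans (by omega)
  have hUi : ∀ s ∈ U, p s = i := by
    intro s hs
    rcases Finset.mem_union.1 hs with h | h <;> obtain ⟨e, he, rfl⟩ := Finset.mem_image.1 h
    · exact (hP e he).2
    · exact (hP e he).1.2.symm.trans (hP e he).2
  set C : Fin r → Finset (Fin n) := fun j =>
    (Finset.univ.filter fun v => p v = j) \ U.biUnion (missing G p) with hC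
  have hmemC : ∀ j v, v ∈ C j ↔ p v = j ∧ ∀ s ∈ U, v ∉ missing G p s := fun j v => by simp [hC]
  have hCcard : ∀ j, r * q * (b + 1) < ((C j).card : ℝ) := by
    intro j
    have h1 := Finset.le_card_sdiff (U.biUnion (missing G p))
      (Finset.univ.filter fun v => p v = j)
    have h1' : ((Finset.univ.filter fun v => p v = j).card : ℝ) ≤
        (C j).card + (U.biUnion (missing G p)).card := by
      exact_mod_cast (by simp only [hC]; omega :
        (Finset.univ.filter fun v => p v = j).card ≤ (C j).card + (U.biUnion (missing G p)).card)
    have h2 : ((U.biUnion (missing G p)).card : ℝ) ≤ (4 * a + 2) * b := by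
      calc ((U.biUnion (missing G p)).card : ℝ) ≤ ∑ s ∈ U, ((missing G p s).card : ℝ) := by
            exact_mod_cast Finset.card_biUnion_le
        _ ≤ ∑ _s ∈ U, b := Finset.sum_le_sum fun s _ => hb s
        _ = U.card * b := by simp
        _ ≤ (4 * a + 2) * b := mul_le_mul_of_nonneg_right (by exact_mod_cast hUcard) hb0
    linarith [hbig j]
  obtain ⟨S, hUS, -, hcross, hScnt⟩ := exists_cross_complete (q := q) G p U C b hb0
    (fun j v hv => ((hmemC j v).1 hv).1) (fun j v _ => hb v)
    (fun j v hv s hs hne => by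
      by_contra hadj
      exact ((hmemC j v).1 hv).2 s hs (mem_missing.2 ⟨fun h => hadj h.symm, hne.symm⟩))
    (fun s hs t ht hne => absurd ((hUi s hs).trans (hUi t ht).symm) hne)
    (fun i => (Finset.card_filter_le _ _).trans (hUcard.trans hqa)) hCcard
  have hle := card_inside_le_of_cross_complete hr hq hG S hScnt hcross
  have hge : P.card ≤ ((S ×ˢ S).filter fun e => G.Adj e.1 e.2 ∧ p e.1 = p e.2).card :=
    Finset.card_le_card fun e he => Finset.mem_filter.2 ⟨Finset.mem_product.2
      ⟨hUS (fst_mem_endpoints he), hUS (snd_mem_endpoints he)⟩, (hP e he).1⟩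
  omega

/-- The Turán bound applied to a bounded balanced set containing all exceptional pairs. -/
lemma card_insidePairs_le_card_missingPairs {W : Type*} {a q : ℕ} (hr : 0 < r)
    {F : SimpleGraph W}
    (hq : ∀ G : SimpleGraph (Fin (r * q)), FFree F G → eCnt G ≤ eCnt (turanGraph (r * q) r) + a)
    (hG : FFree F G) (hcnt : 2 * ((insidePairs G p).card + (missingPairs G p).card) ≤ q)
    (hbig : ∀ i, q ≤ (Finset.univ.filter fun v => p v = i).card) :
    ((insidePairs G p).card : ℝ) ≤ (missingPairs G p).card + 2 * a := by
  set P := insidePairs G p ∪ missingPairs G p with hP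
  have hE : (endpoints P).card ≤ q := (card_endpoints_le P).trans
    ((Nat.mul_le_mul_left 2 (Finset.card_union_le _ _)).trans hcnt)
  have hex : ∀ i, ∃ B : Finset (Fin n), ((endpoints P).filter fun v => p v = i) ⊆ B ∧
      B ⊆ (Finset.univ.filter fun v => p v = i) ∧ B.card = q := fun i =>
    Finset.exists_subsuperset_card_eq (Finset.filter_subset_filter _ (Finset.subset_univ _))
      ((Finset.card_filter_le _ _).trans hE) (hbig i)
  choose B hB1 hB2 hB3 using hex
  have hBp : ∀ i, ∀ v ∈ B i, p v = i := fun i v hv => (Finset.mem_filter.1 (hB2 i hv)).2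
  set U := Finset.univ.biUnion B with hU
  have hUB : ∀ i, (U.filter fun v => p v = i) = B i := by
    intro i
    ext v
    simp only [hU, Finset.mem_filter, Finset.mem_biUnion, Finset.mem_univ, true_and]
    constructor
    · rintro ⟨⟨j, hj⟩, hi⟩
      rwa [← hi, hBp j v hj]
    · exact fun hv => ⟨⟨i, hv⟩, hBp i v hv⟩
  have hEU : endpoints P ⊆ U := fun v hv => Finset.mem_biUnion.2
    ⟨p v, Finset.mem_univ _, hB1 _ (Finset.mem_filter.2 ⟨hv, rfl⟩)⟩
  have h := card_inside_le hr hq hG p U fun i => by rw [hUB, hB3]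
  have hin : insidePairs G p ⊆ (U ×ˢ U).filter fun e => G.Adj e.1 e.2 ∧ p e.1 = p e.2 :=
    fun e he => Finset.mem_filter.2 ⟨Finset.mem_product.2
      ⟨hEU (fst_mem_endpoints (Finset.mem_union_left _ he)),
        hEU (snd_mem_endpoints (Finset.mem_union_left _ he))⟩, mem_insidePairs.1 he⟩
  have hmi : ((U ×ˢ U).filter fun e => ¬ G.Adj e.1 e.2 ∧ p e.1 ≠ p e.2) ⊆ missingPairs G p :=
    fun e he => mem_missingPairs.2 (Finset.mem_filter.1 he).2
  have h1 : ((insidePairs G p).card : ℝ) ≤ _ := Nat.cast_le.2 (Finset.card_le_card hin)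
  have h2 : _ ≤ ((missingPairs G p).card : ℝ) := Nat.cast_le.2 (Finset.card_le_card hmi)
  linarith

namespace IsPerron

variable {x : Fin n → ℝ}

lemma sum_pairs_le (hx : IsPerron G x) {B : ℝ} (hB : ∀ u, x u ≤ B) (P : Finset (Fin n × Fin n)) :
    ∑ e ∈ P, x e.1 * x e.2 ≤ P.card * B ^ 2 := by
  refine (Finset.sum_le_sum (g := fun _ => B ^ 2) fun e _ => ?_).trans (by simp)
  rw [sq]
  exact mul_le_mul (hB _) (hB _) (hx.nonneg _) ((hx.nonneg _).trans (hB e.1))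

lemma sum_pairs_ge (hx : IsPerron G x) {b : ℝ} (hb0 : 0 ≤ b) (hb : ∀ u, b ≤ x u)
    (P : Finset (Fin n × Fin n)) : P.card * b ^ 2 ≤ ∑ e ∈ P, x e.1 * x e.2 := by
  refine le_trans (by simp) (Finset.sum_le_sum (f := fun _ => b ^ 2) fun e _ => ?_)
  rw [sq]
  exact mul_le_mul (hb _) (hb _) hb0 (hx.nonneg _)

end IsPerron

end

section
open scoped Classical

namespace IsPerron

variable {n r : ℕ} {G : SimpleGraph (Fin n)} {p : Fin n → Fin r} {x : Fin n → ℝ}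

lemma sum_sq_sub_sum_part_sq_le (hx : IsPerron G x) (hr : 2 ≤ r)
    (hup : ∀ i, ((Finset.univ.filter fun v => p v = i).card : ℝ) ≤ 3 / 2 * n / r) :
    (∑ u, x u) ^ 2 - ∑ i, (∑ u with p u = i, x u) ^ 2 ≤ (1 - 1 / (r : ℝ)) * n ^ 2
      - (1 - 1 / ((r : ℝ) / 6 + 4 / 3)) *
        (∑ i, ((Finset.univ.filter fun v => p v = i).card : ℝ) ^ 2 - n ^ 2 / r)
      + (∑ u, (x u - 1) ^ 2) ^ 2 / 4 := by
  have hr' : (2 : ℝ) ≤ r := by exact_mod_cast hr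
  have hr0 : (0 : ℝ) < r := by linarith
  set κ : ℝ := (r : ℝ) / 6 + 4 / 3 with hκ
  have hκ0 : 0 < κ := by positivity
  set m : Fin r → ℝ := fun i => ((Finset.univ.filter fun v => p v = i).card : ℝ) with hm
  set s : Fin r → ℝ := fun i => ∑ u with p u = i, x u with hs
  set Qi : Fin r → ℝ := fun i => ∑ u with p u = i, (x u - 1) ^ 2 with hQi
  have hsumm : ∑ i, m i = n := by
    simp only [hm]
    exact_mod_cast sum_card_part p
  have hsums : ∑ i, s i = ∑ u, x u := Finset.sum_fiberwise _ _ _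
  have hsumQ : ∑ i, Qi i = ∑ u, (x u - 1) ^ 2 := Finset.sum_fiberwise _ _ _
  have hQ := hx.sum_sub_one_sq
  have hcs : ∀ i, (s i - m i) ^ 2 ≤ m i * Qi i := by
    intro i
    have h := sq_sum_le_card_mul_sum_sq (s := Finset.univ.filter fun v => p v = i)
      (f := fun u => x u - 1)
    rw [Finset.sum_sub_distrib] at h
    simpa [hs, hm, hQi] using h
  have hQi0 : ∀ i, 0 ≤ Qi i := fun i => Finset.sum_nonneg fun _ _ => sq_nonneg _
  have hterm : ∀ i, -((m i - n / r) ^ 2 * (1 / κ)) ≤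
      (1 - 1 / (r : ℝ)) * n * Qi i + 2 * (m i - n / r) * (s i - m i) + (s i - m i) ^ 2 := by
    intro i
    have h1 : (κ - 1) * m i ≤ (1 - 1 / (r : ℝ)) * n := by
      calc (κ - 1) * m i ≤ (κ - 1) * (3 / 2 * n / r) :=
            mul_le_mul_of_nonneg_left (hup i) (by rw [hκ]; linarith)
        _ = ((r : ℝ) + 2) / (4 * r) * n := by rw [hκ]; field_simp; ring
        _ ≤ (1 - 1 / (r : ℝ)) * n := by
            refine mul_le_mul_of_nonneg_right ?_ (Nat.cast_nonneg _)
            rw [one_sub_div hr0.ne', div_le_div_iff₀ (by positivity) hr0]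
            nlinarith
    have h2 : (κ - 1) * (s i - m i) ^ 2 ≤ (1 - 1 / (r : ℝ)) * n * Qi i :=
      calc (κ - 1) * (s i - m i) ^ 2 ≤ (κ - 1) * (m i * Qi i) :=
            mul_le_mul_of_nonneg_left (hcs i) (by rw [hκ]; linarith)
        _ = (κ - 1) * m i * Qi i := by ring
        _ ≤ _ := mul_le_mul_of_nonneg_right h1 (hQi0 i)
    have h3 : 0 ≤ (κ * (s i - m i) + (m i - n / r)) ^ 2 * (1 / κ) := by positivity
    have h4 : (κ * (s i - m i) + (m i - n / r)) ^ 2 * (1 / κ) = κ * (s i - m i) ^ 2 +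
        2 * (m i - n / r) * (s i - m i) + (m i - n / r) ^ 2 * (1 / κ) := by
      field_simp; ring
    linarith
  have hD : ∑ i, (m i - n / r) ^ 2 = ∑ i, m i ^ 2 - n ^ 2 / r := by
    have : ∀ i, (m i - n / r) ^ 2 = m i ^ 2 - 2 * (n / r) * m i + (n / r) ^ 2 := fun i => by ring
    simp only [this, Finset.sum_add_distrib, Finset.sum_sub_distrib, ← Finset.mul_sum, hsumm,
      Finset.sum_const, Finset.card_univ, Fintype.card_fin, nsmul_eq_mul]
    field_simp; ring
  have hsum := Finset.sum_le_sum (s := Finset.univ) fun i _ => hterm i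
  rw [Finset.sum_neg_distrib, ← Finset.sum_mul, hD] at hsum
  have hexp : ∀ i, (1 - 1 / (r : ℝ)) * n * Qi i + 2 * (m i - n / r) * (s i - m i) +
      (s i - m i) ^ 2 = (1 - 1 / (r : ℝ)) * n * Qi i + s i ^ 2 - m i ^ 2
        - 2 * (n / r) * s i + 2 * (n / r) * m i := fun i => by ring
  simp only [hexp, Finset.sum_add_distrib, Finset.sum_sub_distrib, ← Finset.mul_sum, hsumm,
    hsums, hsumQ] at hsum
  have hS : ∑ u, x u = n - (∑ u, (x u - 1) ^ 2) / 2 := by linarith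
  set Q := ∑ u, (x u - 1) ^ 2
  rw [hS] at hsum ⊢
  have e1 : (n : ℝ) / r = n * (1 / r) := by ring
  have e2 : (n : ℝ) ^ 2 / r = n ^ 2 * (1 / r) := by ring
  rw [e1] at hsum
  rw [e2] at hsum ⊢
  linarith

/-- An unbalanced partition costs the spectral radius at least one half. -/
lemma half_add_le (hx : IsPerron G x) (hr : 2 ≤ r) {a q : ℕ} {t : Fin r → ℕ}
    (ht : ∀ i, t i = q ∨ t i = q + 1) (htn : ∑ i, t i = n)
    (hlow : (n : ℝ) ^ 2 - ∑ i, (t i : ℝ) ^ 2 + 2 * a ≤ specRad G * n)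
    (hup : ∀ i, ((Finset.univ.filter fun v => p v = i).card : ℝ) ≤ 3 / 2 * n / r)
    {i j : Fin r} (hij : (Finset.univ.filter fun v => p v = i).card + 2 ≤
      (Finset.univ.filter fun v => p v = j).card) :
    1 / 2 + 2 * (a : ℝ) ≤ (∑ u, (x u - 1) ^ 2) ^ 2 / 4 +
      (∑ e ∈ insidePairs G p, x e.1 * x e.2 - ∑ e ∈ missingPairs G p, x e.1 * x e.2) := by
  have hr' : (2 : ℝ) ≤ r := by exact_mod_cast hr
  have h1 := hx.sum_sq_sub_sum_part_sq_le hr hup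
  have h2 := sum_sq_add_two_le t (fun i => (Finset.univ.filter fun v => p v = i).card) ht
    (htn.trans (sum_card_part p).symm) hij
  have h3 := sum_sq_le_of_balanced (by omega) t ht
  have h4 : ∑ i, (t i : ℝ) = n := by exact_mod_cast htn
  rw [h4] at h3
  have hdec := adjForm_decomp G p x
  rw [hx.adjForm_eq] at hdec
  have e2 : (n : ℝ) ^ 2 / r = n ^ 2 * (1 / r) := by ring
  rw [e2] at h1
  set κ : ℝ := (r : ℝ) / 6 + 4 / 3 with hκ
  have hκ0 : 0 < κ := by positivity
  have hκ1 : 0 ≤ 1 - 1 / κ := by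
    rw [sub_nonneg, div_le_one hκ0]; rw [hκ]; linarith
  have h5 := mul_le_mul_of_nonneg_left h2 hκ1
  have h6 : (2 + (∑ i, (t i : ℝ) ^ 2 - n ^ 2 * (1 / r))) * (1 / κ) ≤ 3 / 2 := by
    rw [mul_one_div, div_le_iff₀ hκ0]; rw [hκ]; linarith
  nlinarith

lemma sum_inside_sub_sum_missing_le (hx : IsPerron G x) {δ : ℝ} (hδ : 0 ≤ δ) (hδ1 : δ ≤ 1)
    (hdev : ∑ u, (x u - 1) ^ 2 ≤ δ ^ 2) {P M : Finset (Fin n × Fin n)} :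
    ∑ e ∈ P, x e.1 * x e.2 - ∑ e ∈ M, x e.1 * x e.2 ≤
      P.card - M.card + 3 * δ * (P.card + M.card) := by
  have habs : ∀ u, |x u - 1| ≤ δ := fun u =>
    abs_le_of_sq_le_sq ((Finset.single_le_sum (f := fun u => (x u - 1) ^ 2)
      (fun u _ => sq_nonneg _) (Finset.mem_univ u)).trans hdev) hδ
  have h1 := hx.sum_pairs_le (B := 1 + δ) (fun u => by linarith [(abs_le.1 (habs u)).2]) P
  have h2 := hx.sum_pairs_ge (b := 1 - δ) (by linarith)
    (fun u => by linarith [(abs_le.1 (habs u)).1]) M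
  have h3 : (1 + δ) ^ 2 ≤ 1 + 3 * δ := by nlinarith
  have h4 : 1 - 3 * δ ≤ (1 - δ) ^ 2 := by nlinarith
  have h5 := mul_le_mul_of_nonneg_left h3 (Nat.cast_nonneg (α := ℝ) P.card)
  have h6 := mul_le_mul_of_nonneg_left h4 (Nat.cast_nonneg (α := ℝ) M.card)
  linarith

end IsPerron

end

section
open scoped Classical

variable {n r : ℕ} {G : SimpleGraph (Fin n)} {p : Fin n → Fin r}

/-- Once every Perron entry is bounded away from zero and infinity and boundedly many pairs are
inside the classes, the partition is balanced. -/
lemma IsPerron.balanced_of_card_insidePairs_le {W : Type*} {F : SimpleGraph W} {a q q' : ℕ}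
    {x : Fin n → ℝ} {t : Fin r → ℕ} {δ : ℝ} (hx : IsPerron G x) (hr : 2 ≤ r) (hn : 0 < n)
    (hG : FFree F G)
    (hq' : ∀ H : SimpleGraph (Fin (r * q')), FFree F H → eCnt H ≤ eCnt (turanGraph (r * q') r) + a)
    (ht : ∀ i, t i = q ∨ t i = q + 1) (htn : ∑ i, t i = n)
    (hlow : (n : ℝ) ^ 2 - ∑ i, (t i : ℝ) ^ 2 + 2 * a ≤ specRad G * n)
    (hup : ∀ i, ((Finset.univ.filter fun v => p v = i).card : ℝ) ≤ 3 / 2 * n / r)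
    (hbig : ∀ i, q' ≤ (Finset.univ.filter fun v => p v = i).card)
    (hx4 : ∀ u, 1 / 4 ≤ x u ∧ x u ≤ 4) (hin : (insidePairs G p).card ≤ r * (2 * a))
    (hqB : 2 * (514 * r * a + 4 * r) ≤ q') (hδ0 : 0 < δ)
    (hδ : 12 * δ * (514 * r * a + 4 * r + 1) ≤ 1) (hδn : 128 * (r : ℝ) * a + r ≤ δ ^ 2 * n)
    (i j : Fin r) :
    (Finset.univ.filter fun v => p v = j).card ≤ (Finset.univ.filter fun v => p v = i).card + 1 := by
  by_contra hcon
  have hij : (Finset.univ.filter fun v => p v = i).card + 2 ≤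
    (Finset.univ.filter fun v => p v = j).card := by omega
  have hn' : (0 : ℝ) < n := by exact_mod_cast hn
  have hr' : (2 : ℝ) ≤ r := by exact_mod_cast hr
  have hra : (0 : ℝ) ≤ r * a := by positivity
  have hlow' : (1 - 1 / (r : ℝ)) * n ^ 2 - r / 4 ≤ specRad G * n := by
    have h3 := sum_sq_le_of_balanced (by omega) t ht
    have h4 : ∑ i, (t i : ℝ) = n := by exact_mod_cast htn
    rw [h4] at h3
    linarith [Nat.cast_nonneg (α := ℝ) a]
  obtain ⟨hM, hQ⟩ := hx.missing_and_deviation_le hr hn p hlow'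
  have hin' : ((insidePairs G p).card : ℝ) ≤ r * (2 * a) := by exact_mod_cast hin
  have hI := hx.sum_pairs_le (fun u => (hx4 u).2) (insidePairs G p)
  have hMge := hx.sum_pairs_ge (by norm_num) (fun u => (hx4 u).1) (missingPairs G p)
  have hmiss : ((missingPairs G p).card : ℝ) ≤ 512 * r * a + 4 * r := by linarith
  have htot : ((insidePairs G p).card : ℝ) + (missingPairs G p).card ≤
      514 * r * a + 4 * r := by linarith
  have hdiff := card_insidePairs_le_card_missingPairs (by omega) hq' hG
    (le_trans (Nat.mul_le_mul_left 2 (by exact_mod_cast htot)) hqB) hbig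
  have hQδ : ∑ u, (x u - 1) ^ 2 ≤ δ ^ 2 := by
    refine le_of_mul_le_mul_left (hQ.trans ?_) hn'
    linarith
  have hδ1 : δ ≤ 1 / 12 := by nlinarith
  have h1 := hx.half_add_le hr ht htn hlow hup hij
  have h2 := hx.sum_inside_sub_sum_missing_le hδ0.le (by linarith) hQδ (P := insidePairs G p)
    (M := missingPairs G p)
  have hQ0 : 0 ≤ ∑ u, (x u - 1) ^ 2 := Finset.sum_nonneg fun _ _ => sq_nonneg _
  have h3 : (∑ u, (x u - 1) ^ 2) ^ 2 ≤ δ := by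
    have : (∑ u, (x u - 1) ^ 2) ^ 2 ≤ (δ ^ 2) ^ 2 := pow_le_pow_left₀ hQ0 hQδ 2
    have h4 : δ ^ 2 ≤ δ := by nlinarith
    nlinarith
  have h5 := mul_le_mul_of_nonneg_left htot hδ0.le
  linarith

/-- In a spectral-extremal graph, a maximum cut with few inside edges and almost equal class sizes
is balanced. -/
lemma SpecExtremal.balanced {W : Type*} [Fintype W] {F : SimpleGraph W} {a m₀ q q' : ℕ}
    {τ δ : ℝ} (hr : 2 ≤ r)
    (hm₀ : ∀ m ≥ m₀, (∀ H : SimpleGraph (Fin m), FFree F H → eCnt H ≤ eCnt (turanGraph m r) + a) ∧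
      ∃ H : SimpleGraph (Fin m), FFree F H ∧ eCnt H = eCnt (turanGraph m r) + a)
    (hq : m₀ ≤ q) (hqa : 4 * a + 2 ≤ q) (hq' : m₀ ≤ q') (hqB : 2 * (514 * r * a + 4 * r) ≤ q')
    (hτ0 : 0 < τ)
    (hτ : (10 * Fintype.card W + (10 * r * q + 33) * (r * q + 4 * a + 2) + 100) * τ ≤
      1 / (r : ℝ) / 4)
    (hδ0 : 0 < δ) (hδ : 12 * δ * (514 * r * a + 4 * r + 1) ≤ 1)
    (hn : 0 < n) (hnm : m₀ ≤ n) (hnr : (r : ℝ) ≤ τ ^ 2 * n)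
    (hnW : (Fintype.card W : ℝ) < 1 / r / 4 * n) (hnq : (r : ℝ) * q < τ * n)
    (hnq2 : (r : ℝ) * q < 1 / r / 4 * n) (hnq' : (q' : ℝ) < 1 / r / 2 * n)
    (hδn : 128 * (r : ℝ) * a + r < δ ^ 2 * n)
    (hG : SpecExtremal F G) (hmax : ∀ p' : Fin n → Fin r, crossCnt G p' ≤ crossCnt G p)
    (hin : ((insidePairs G p).card : ℝ) ≤ 2 * τ ^ 4 * n ^ 2)
    (hsize : ∀ i, (1 / (r : ℝ) - 3 * τ ^ 2) * n ≤ (Finset.univ.filter fun v => p v = i).card ∧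
      ((Finset.univ.filter fun v => p v = i).card : ℝ) ≤ (1 / r + 3 * τ ^ 2) * n) (i j : Fin r) :
    (Finset.univ.filter fun v => p v = j).card ≤ (Finset.univ.filter fun v => p v = i).card + 1 := by
  have hr0 : 0 < r := by omega
  have hn' : (1 : ℝ) ≤ n := by exact_mod_cast hn
  have hr' : (2 : ℝ) ≤ r := by exact_mod_cast hr
  have hrq : ∀ k, k ≤ r * k := fun k => Nat.le_mul_of_pos_left k hr0
  obtain ⟨x, hx0, hx1, hx2⟩ := exists_perron hn G
  have hx : IsPerron G x := ⟨hx0, hx1, hx2⟩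
  obtain ⟨q₀, t, ht, htn, hlow⟩ := hG.specRad_mul_ge hr0 (hm₀ n hnm).2
  have hlow' : (1 - 1 / (r : ℝ)) * n ^ 2 - r / 4 ≤ specRad G * n := by
    have h3 := sum_sq_le_of_balanced hr0 t ht
    have h4 : ∑ i, (t i : ℝ) = n := by exact_mod_cast htn
    rw [h4] at h3
    linarith [Nat.cast_nonneg (α := ℝ) a]
  have hι : 1 / (r : ℝ) ≤ 1 / 2 := one_div_le_one_div_of_le (by norm_num) hr'
  have hι0 : 0 < 1 / (r : ℝ) := by positivity
  have e1 : 3 / 2 * (n : ℝ) / r = 3 / 2 * (1 / r) * n := by ring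
  have hW0 : (0 : ℝ) ≤ Fintype.card W * τ := by positivity
  have hβ0 : (0 : ℝ) ≤ (10 * r * q + 33) * (r * q + 4 * a + 2) * τ := by positivity
  have hτ100 : 100 * τ ≤ 1 / (r : ℝ) / 4 := by linarith
  have hτW : 10 * Fintype.card W * τ ≤ 1 / (r : ℝ) / 4 := by linarith
  have hτβ : (10 * r * q + 33) * (r * q + 4 * a + 2) * τ ≤ 1 / (r : ℝ) / 4 := by linarith
  clear hτ hW0 hβ0
  have hτ2 : τ ^ 2 ≤ τ := by
    rw [sq]
    exact mul_le_of_le_one_left hτ0.le (by linarith)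
  have hτι : 3 * τ ^ 2 * n ≤ 1 / 2 * (1 / (r : ℝ)) * n :=
    mul_le_mul_of_nonneg_right (by linarith) (Nat.cast_nonneg _)
  have hup : ∀ i, ((Finset.univ.filter fun v => p v = i).card : ℝ) ≤ 3 / 2 * n / r := by
    intro i
    rw [e1]
    linarith [(hsize i).2]
  have hlo : ∀ i, 1 / (r : ℝ) / 2 * n ≤ (Finset.univ.filter fun v => p v = i).card := by
    intro i
    linarith [(hsize i).1]
  set ι := 1 / (r : ℝ)
  have hnr2 : (r : ℝ) ≤ τ ^ 2 * n ^ 2 := by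
    have : τ ^ 2 * n ≤ τ ^ 2 * n ^ 2 := mul_le_mul_of_nonneg_left (by nlinarith) (sq_nonneg _)
    linarith
  obtain ⟨hatyp, hdev⟩ := hx.rough_estimates hr hn hlow' hτ0 hin hnr2
  have hspec : (n : ℝ) / 4 ≤ specRad G := by
    refine le_of_mul_le_mul_right (le_trans ?_ hlow') (by linarith : (0 : ℝ) < n)
    have h1 : (r : ℝ) ≤ 1 / 2 * n ^ 2 := hnr2.trans
      (mul_le_mul_of_nonneg_right (by linarith) (sq_nonneg _))
    have h2 : 1 / 2 * (n : ℝ) ^ 2 ≤ (1 - ι) * n ^ 2 :=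
      mul_le_mul_of_nonneg_right (by linarith) (sq_nonneg _)
    rw [show (n : ℝ) / 4 * n = 1 / 4 * n ^ 2 by ring]
    linarith
  have hpos : 0 < specRad G := by linarith
  have hent : ∀ u, (1 - ι - 16 * τ) * n ≤ specRad G * x u := by
    refine hx.specRad_mul_ge hG hpos hτ0.le (by linarith) hatyp hdev (fun i => (hsize i).2)
      fun i => lt_of_lt_of_le ?_ (hlo i)
    have := mul_le_mul_of_nonneg_right hτW (Nat.cast_nonneg (α := ℝ) n)
    linarith
  have hx4 : ∀ u, 1 / 4 ≤ x u ∧ x u ≤ 4 := by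
    intro u
    have h0 := hx.nonneg u
    constructor
    · refine le_of_mul_le_mul_left ?_ (by linarith : (0 : ℝ) < n)
      have h1 : (1 / 4 : ℝ) * n ≤ (1 - ι - 16 * τ) * n :=
        mul_le_mul_of_nonneg_right (by linarith) (Nat.cast_nonneg _)
      have h2 := mul_le_mul_of_nonneg_right (hx.specRad_le hn) h0
      linarith [hent u]
    · refine le_of_mul_le_mul_left ?_ (by linarith : (0 : ℝ) < n)
      have h2 := mul_le_mul_of_nonneg_right hspec h0
      linarith [hx.specRad_mul_le u]
  have hmiss : ∀ w, ((missing G p w).card : ℝ) ≤ (10 * r * q + 33) * τ * n := fun w =>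
    card_missing_le w (hx.card_nbrs_ge hdev w (hent w))
      (card_own_nbrs_lt hr0 (hm₀ _ (hq.trans (hrq q))).1 (by omega) hG.1 hmax hτ0.le hatyp hnq w).le
      (hsize _).1 (by linarith)
  refine hx.balanced_of_card_insidePairs_le hr hn hG.1 (hm₀ _ (hq'.trans (hrq q'))).1 ht htn hlow
    hup (fun i => ?_) hx4 ?_ hqB hδ0 hδ hδn.le i j
  · exact_mod_cast hnq'.le.trans (hlo i)
  · refine card_insidePairs_le_of_missing_le hr0 (hm₀ _ (hq.trans (hrq q))).1 hqa hG.1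
      (by positivity) hmiss fun i => lt_of_lt_of_le ?_ (hlo i)
    have := mul_le_mul_of_nonneg_right hτβ (Nat.cast_nonneg (α := ℝ) n)
    linarith

end

theorem stmt_15 {W : Type*} (r a : ℕ) (hr : 2 ≤ r) (F : SimpleGraph W) (h : HypStar r a F) :
    ∃ ℓ₀ : ℕ, ∀ ℓ ≥ ℓ₀, ∀ θ ε : ℝ, 0 < θ → 0 < ε →
      θ < 1 / (100 * r ^ 5 * ℓ) → 2 * ε < θ ^ 3 →
      ∃ n₀ : ℕ, ∀ n ≥ n₀, ∀ G : SimpleGraph (Fin n), SpecExtremal F G →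
        ∀ p : Fin n → Fin r, GoodPartition r G ε p →
          ∀ i j : Fin r, |(partSize p i : ℤ) - (partSize p j : ℤ)| ≤ 1 := by
  classical
  have := h.finite hr
  have := Fintype.ofFinite W
  obtain ⟨m₀, hm₀⟩ := h.turan_number hr
  have hr' : (2 : ℝ) ≤ r := by exact_mod_cast hr
  have hι0 : 0 < 1 / (r : ℝ) := by positivity
  set q := m₀ + 4 * a + 2 with hq
  set q' := m₀ + 2 * (514 * r * a + 4 * r) with hq'
  set Z : ℝ := 10 * Fintype.card W + (10 * r * q + 33) * (r * q + 4 * a + 2) + 100 with hZ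
  have hZ0 : 0 < Z := by positivity
  set c : ℝ := 1 / (r : ℝ) / 4 / Z with hc
  have hc0 : 0 < c := by positivity
  refine ⟨⌈1 / c ^ 4⌉₊ + 1, fun ℓ hℓ θ ε hθ0 hε0 hθ hεθ => ?_⟩
  set τ := √(√ε) with hτ
  have hτ0 : 0 < τ := Real.sqrt_pos.2 (Real.sqrt_pos.2 hε0)
  have hτ2 : τ ^ 2 = √ε := Real.sq_sqrt (Real.sqrt_nonneg _)
  have hτ4 : τ ^ 4 = ε := by
    rw [show τ ^ 4 = (τ ^ 2) ^ 2 by ring, hτ2, Real.sq_sqrt hε0.le]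
  have hℓ1 : 1 / c ^ 4 ≤ (ℓ : ℝ) := by
    refine (Nat.le_ceil _).trans ?_
    exact_mod_cast (Nat.le_succ _).trans hℓ
  have hℓ0 : (1 : ℝ) ≤ ℓ := by exact_mod_cast (Nat.le_add_left 1 _).trans hℓ
  have hθℓ : θ < 1 / ℓ := by
    refine hθ.trans_le (one_div_le_one_div_of_le (by linarith) ?_)
    have : (1 : ℝ) ≤ 100 * r ^ 5 := by
      have : (1 : ℝ) ≤ r ^ 5 := one_le_pow₀ (by linarith)
      linarith
    nlinarith
  have hθc : θ ≤ c ^ 4 := by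
    refine hθℓ.le.trans ?_
    rw [div_le_iff₀ (by linarith)]
    rwa [div_le_iff₀ (by positivity), mul_comm] at hℓ1
  have hθ1 : θ ≤ 1 := hθℓ.le.trans (by rw [div_le_one (by linarith)]; exact hℓ0)
  have hτc : τ ≤ c := by
    refine le_of_pow_le_pow_left₀ (n := 4) (by norm_num) hc0.le ?_
    rw [hτ4]
    have : θ ^ 3 ≤ θ := by
      calc θ ^ 3 = θ * θ ^ 2 := by ring
        _ ≤ θ * 1 := mul_le_mul_of_nonneg_left (pow_le_one₀ hθ0.le hθ1) hθ0.le
        _ = θ := mul_one θ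
    linarith
  have hZτ : Z * τ ≤ 1 / (r : ℝ) / 4 := by
    rw [hc, le_div_iff₀ hZ0] at hτc
    linarith
  set δ : ℝ := 1 / (12 * (514 * r * a + 4 * r + 1)) with hδ
  have hδ0 : 0 < δ := by positivity
  have hδ1 : 12 * δ * (514 * r * a + 4 * r + 1) ≤ 1 := by
    rw [hδ]; field_simp; rfl
  have hlarge : ∀ c' : ℝ, 0 < c' → ∀ A : ℝ, ∀ᶠ n : ℕ in Filter.atTop, A < c' * n :=
    fun c' hc' A => ((tendsto_natCast_atTop_atTop (R := ℝ)).const_mul_atTop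
      hc').eventually_gt_atTop A
  obtain ⟨n₀, hn₀⟩ := Filter.eventually_atTop.1 ((Filter.eventually_ge_atTop (m₀ + 1)).and
    ((hlarge (τ ^ 2) (by positivity) r).and
    ((hlarge (1 / r / 4) (by positivity) (Fintype.card W)).and
    ((hlarge τ hτ0 (r * q)).and
    ((hlarge (1 / r / 4) (by positivity) (r * q)).and
    ((hlarge (1 / r / 2) (by positivity) q').and
    (hlarge (δ ^ 2) (by positivity) (128 * (r : ℝ) * a + r))))))))
  refine ⟨n₀, fun n hn G hG p hp => ?_⟩
  obtain ⟨h1, h2, h3, h4, h5, h6, h7⟩ := hn₀ n hn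
  obtain ⟨hmax, hin, hsize⟩ := hp
  have hbal := hG.balanced hr hm₀ (q := q) (q' := q') (by omega) (by omega) (by omega) (by omega)
    hτ0 hZτ hδ0 hδ1 (by omega) (by omega) h2.le h3 h4 h5 h6 h7 hmax
    (by rw [← two_mul_sum_inCnt, hτ4]; linarith)
    (fun i => by
      rw [hτ2]
      have := hsize i
      rw [partSize_eq] at this
      exact ⟨this.1.le, this.2.le⟩)
  intro i j
  rw [partSize_eq, partSize_eq, abs_le]
  have := hbal i j
  have := hbal j i
  omega
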